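/- arXiv:nlin/0212044 — 4 statements merged into one kernel-verified Lean document; each statement's English description precedes it below -/
import Mathlib

section
/- Let λ ∈ ℝ, let V ⊆ ℝ² be open, and let u : V → ℝ be a smooth solution of the Korteweg–de Vries equation ∂ₜu = ∂ₓₓₓu + 6u·∂ₓu. Then the functions f₁₁ = 1 − u, f₂₁ = λ, f₃₁ = −1 − u, f₁₂ = λ·∂ₓu − ∂ₓₓu + (1 − u)·(λ² + 2u), f₂₂ = λ·(λ² + 2u) − 2∂ₓu, f₃₂ = λ·∂ₓu − ∂ₓₓu − (1 + u)·(λ² + 2u) satisfy the structure equations of a pseudo-spherical surface on V. -/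
open Real

/-- Partial derivative with respect to the first coordinate `x` of `ℝ × ℝ`. -/
noncomputable def pdx (f : ℝ × ℝ → ℝ) (p : ℝ × ℝ) : ℝ := fderiv ℝ f p (1, 0)

/-- Partial derivative with respect to the second coordinate `t` of `ℝ × ℝ`. -/
noncomputable def pdt (f : ℝ × ℝ → ℝ) (p : ℝ × ℝ) : ℝ := fderiv ℝ f p (0, 1)

/-- The coefficients `f_{αβ}` of the one-forms `ω^α = f_{α1} dx + f_{α2} dt` satisfy the
structure equations of a pseudo-spherical surface on `V`:
`dω¹ = ω³ ∧ ω², dω² = ω¹ ∧ ω³, dω³ = ω¹ ∧ ω²`. -/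
def StructEq (V : Set (ℝ × ℝ)) (f11 f12 f21 f22 f31 f32 : ℝ × ℝ → ℝ) : Prop :=
  ∀ p ∈ V,
    pdx f12 p - pdt f11 p = f31 p * f22 p - f32 p * f21 p ∧
    pdx f22 p - pdt f21 p = f11 p * f32 p - f12 p * f31 p ∧
    pdx f32 p - pdt f31 p = f11 p * f22 p - f12 p * f21 p

/-- The `x`-derivative of a smooth function on an open set is smooth there. -/
theorem ContDiffOn.pdx {V : Set (ℝ × ℝ)} {f : ℝ × ℝ → ℝ} (hf : ContDiffOn ℝ (⊤ : ℕ∞) f V)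
    (hV : IsOpen V) : ContDiffOn ℝ (⊤ : ℕ∞) (pdx f) V :=
  (hf.fderiv_of_isOpen hV (by simp)).clm_apply contDiffOn_const

/-- A smooth function on an open set has its Fréchet derivative at each point of the set. -/
theorem ContDiffOn.hasFDerivAt_of_isOpen {V : Set (ℝ × ℝ)} {f : ℝ × ℝ → ℝ}
    (hf : ContDiffOn ℝ (⊤ : ℕ∞) f V) (hV : IsOpen V) {p : ℝ × ℝ} (hp : p ∈ V) :
    HasFDerivAt f (fderiv ℝ f p) p :=
  ((hf.differentiableOn (by simp)).differentiableAt (hV.mem_nhds hp)).hasFDerivAt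

/-- the KdV equation `u_t = u_{xxx} + 6 u u_x` describes pseudo-spherical
surfaces, with the Chern–Peng one-forms with spectral parameter `lam`. -/
theorem kdv_describes_pss
    (lam : ℝ)
    (V : Set (ℝ × ℝ)) (hV : IsOpen V)
    (u : ℝ × ℝ → ℝ) (hu : ContDiffOn ℝ (⊤ : ℕ∞) u V)
    (hkdv : ∀ p ∈ V,
      pdt u p = pdx (pdx (pdx u)) p + 6 * u p * pdx u p) :
    StructEq V
      (fun p => 1 - u p)
      (fun p => lam * pdx u p - pdx (pdx u) p + (1 - u p) * (lam ^ 2 + 2 * u p))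
      (fun _ => lam)
      (fun p => lam * (lam ^ 2 + 2 * u p) - 2 * pdx u p)
      (fun p => -1 - u p)
      (fun p => lam * pdx u p - pdx (pdx u) p - (1 + u p) * (lam ^ 2 + 2 * u p)) := by
  intro p hp
  have hu0 := hu.hasFDerivAt_of_isOpen hV hp
  have hu1 := (hu.pdx hV).hasFDerivAt_of_isOpen hV hp
  have hu2 := ((hu.pdx hV).pdx hV).hasFDerivAt_of_isOpen hV hp
  have h11 := hu0.const_sub 1
  have h31 := hu0.const_sub (-1)
  have hq := (hu0.const_mul 2).const_add (lam ^ 2)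
  have hw := (hu1.const_mul lam).sub hu2
  have h12 := hw.add (h11.mul hq)
  have h22 := (hq.const_mul lam).sub (hu1.const_mul 2)
  have h32 := hw.sub ((hu0.const_add 1).mul hq)
  have e11 : pdt (fun p => 1 - u p) p = -pdt u p := by
    unfold pdt; rw [h11.fderiv]; rfl
  have e31 : pdt (fun p => -1 - u p) p = -pdt u p := by
    unfold pdt; rw [h31.fderiv]; rfl
  have e21 : pdt (fun _ => lam) p = 0 := by simp [pdt]
  have e12 : pdx (fun p => lam * pdx u p - pdx (pdx u) p + (1 - u p) * (lam ^ 2 + 2 * u p)) p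
      = lam * pdx (pdx u) p - pdx (pdx (pdx u)) p
        + ((1 - u p) * (2 * pdx u p) + (lam ^ 2 + 2 * u p) * -pdx u p) :=
    congrArg (fun L : ℝ × ℝ →L[ℝ] ℝ => L (1, 0)) h12.fderiv
  have e22 : pdx (fun p => lam * (lam ^ 2 + 2 * u p) - 2 * pdx u p) p
      = lam * (2 * pdx u p) - 2 * pdx (pdx u) p :=
    congrArg (fun L : ℝ × ℝ →L[ℝ] ℝ => L (1, 0)) h22.fderiv
  have e32 : pdx (fun p => lam * pdx u p - pdx (pdx u) p - (1 + u p) * (lam ^ 2 + 2 * u p)) p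
      = lam * pdx (pdx u) p - pdx (pdx (pdx u)) p
        - ((1 + u p) * (2 * pdx u p) + (lam ^ 2 + 2 * u p) * pdx u p) :=
    congrArg (fun L : ℝ × ℝ →L[ℝ] ℝ => L (1, 0)) h32.fderiv
  have hk := hkdv p hp
  refine ⟨?_, ?_, ?_⟩
  · rw [e12, e11, hk]; ring
  · rw [e22, e21]; ring
  · rw [e32, e31, hk]; ring
end

section
/- Let m ≥ 2, let V ⊆ ℝ^m be open, and let Θ¹, Θ², Θ³ : V → ℝ^m be smooth coefficient maps of one-forms satisfying the structure equations of a pseudo-spherical surface in m variables. Then for every point p ∈ V and every θ₀ ∈ ℝ there exist an open neighborhood U ⊆ V of p and a smooth function θ : U → ℝ with θ(p) = θ₀ such that for every coordinate index A: ∂_A θ = Θ¹_A·cos θ + Θ²_A·sin θ − Θ³_A on U (i.e., θ solves the completely integrable Pfaffian system dθ = Θ¹ cos θ + Θ² sin θ − Θ³). -/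
open Real

/-- Partial derivative in the `A`-th coordinate direction of `ℝ^m = Fin m → ℝ`. -/
noncomputable def pd {m : ℕ} (A : Fin m) (f : (Fin m → ℝ) → ℝ) (p : Fin m → ℝ) : ℝ :=
  fderiv ℝ f p (Pi.single A 1)

/-- The coefficient maps `Θ¹, Θ², Θ³ : V → ℝ^m` of one-forms `Θ^α = Σ_A Θ^α_A dz_A`
satisfy the structure equations of a pseudo-spherical surface in `m` variables:
`dΘ¹ = Θ³ ∧ Θ², dΘ² = Θ¹ ∧ Θ³, dΘ³ = Θ¹ ∧ Θ²`. -/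
def StructEqM {m : ℕ} (V : Set (Fin m → ℝ)) (Θ1 Θ2 Θ3 : (Fin m → ℝ) → Fin m → ℝ) : Prop :=
  ∀ p ∈ V, ∀ A B : Fin m,
    pd A (fun q => Θ1 q B) p - pd B (fun q => Θ1 q A) p
      = Θ3 p A * Θ2 p B - Θ3 p B * Θ2 p A ∧
    pd A (fun q => Θ2 q B) p - pd B (fun q => Θ2 q A) p
      = Θ1 p A * Θ3 p B - Θ1 p B * Θ3 p A ∧
    pd A (fun q => Θ3 q B) p - pd B (fun q => Θ3 q A) p
      = Θ1 p A * Θ2 p B - Θ1 p B * Θ2 p A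

section Frobenius

open Set Metric Filter Topology NNReal
open scoped ContDiff

/-- Picard–Lindelöf, together with the fact that the solution stays in the ball. -/
theorem IsPicardLindelof.exists_mem_closedBall_hasDerivWithinAt
    {G : Type*} [NormedAddCommGroup G] [NormedSpace ℝ G] [CompleteSpace G]
    {f : ℝ → G → G} {tmin tmax : ℝ} {t₀ : Icc tmin tmax} {x₀ : G} {a L K : ℝ≥0}
    (hf : IsPicardLindelof f t₀ x₀ a 0 L K) :
    ∃ α : ℝ → G, α t₀ = x₀ ∧ ∀ t ∈ Icc tmin tmax, α t ∈ closedBall x₀ a ∧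
      HasDerivWithinAt α (f t (α t)) (Icc tmin tmax) t := by
  have hx : x₀ ∈ closedBall x₀ ((0 : ℝ≥0) : ℝ) := mem_closedBall_self le_rfl
  obtain ⟨α, hα⟩ := ODE.FunSpace.exists_isFixedPt_next hf hx
  refine ⟨α.compProj, by rw [ODE.FunSpace.compProj_val, ← hα, ODE.FunSpace.next_apply₀],
    fun t ht ↦ ⟨α.compProj_mem_closedBall hf.mul_max_le, ?_⟩⟩
  apply ODE.hasDerivWithinAt_picard_Icc t₀.2 hf.continuousOn_uncurry
    α.continuous_compProj.continuousOn (fun _ _ ↦ α.compProj_mem_closedBall hf.mul_max_le)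
    x₀ ht |>.congr_of_mem _ ht
  intro t' ht'
  nth_rw 1 [← hα]
  rw [ODE.FunSpace.compProj_of_mem ht', ODE.FunSpace.next_apply]

/-- A form of Grönwall's inequality on the unit interval. -/
theorem norm_le_two_mul_of_norm_deriv_le_norm_add
    {G : Type*} [NormedAddCommGroup G] [NormedSpace ℝ G] {f f' : ℝ → G} {ε : ℝ} (hε : 0 ≤ ε)
    (hf : ∀ t ∈ Icc (0 : ℝ) 1, HasDerivWithinAt f (f' t) (Icc 0 1) t) (h0 : f 0 = 0)
    (bound : ∀ t ∈ Icc (0 : ℝ) 1, ‖f' t‖ ≤ ‖f t‖ + ε) :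
    ∀ t ∈ Icc (0 : ℝ) 1, ‖f t‖ ≤ 2 * ε := by
  intro t ht
  have key := norm_le_gronwallBound_of_norm_deriv_right_le (δ := 0) (K := 1) (ε := ε)
    (fun t ht ↦ (hf t ht).continuousWithinAt)
    (fun t ht ↦ (hf t (Ico_subset_Icc_self ht)).mono_of_mem_nhdsWithin
      (Icc_mem_nhdsGE_of_mem ht)) (by simp [h0])
    (fun t ht ↦ by simpa using bound t (Ico_subset_Icc_self ht)) t ht
  rw [gronwallBound_of_K_ne_0 one_ne_zero] at key
  have he : Real.exp t ≤ 3 :=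
    (Real.exp_le_exp.2 ht.2).trans (by linarith [Real.exp_one_lt_d9])
  simp only [zero_mul, zero_add, div_one, one_mul, sub_zero] at key
  nlinarith

variable {E G : Type*} [NormedAddCommGroup E] [NormedSpace ℝ E]
  [NormedAddCommGroup G] [NormedSpace ℝ G]

/-- If the total differential equation `dy = F (x, y)` satisfies the Frobenius integrability
condition, then its solutions along two rays issuing from the same point agree to second order
with the prescribed differential. -/
theorem norm_radial_solution_sub_le {F : E × G → E →L[ℝ] G} {S : Set (E × G)}
    (hS : Convex ℝ S) (hd : ∀ u ∈ S, DifferentiableAt ℝ F u)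
    (hint : ∀ u ∈ S, ∀ h v, fderiv ℝ F u (h, F u h) v = fderiv ℝ F u (v, F u v) h)
    {M K L : ℝ} (hK0 : 0 ≤ K) (hL0 : 0 ≤ L)
    (hM : ∀ u ∈ S, ‖F u‖ ≤ M) (hK : ∀ u ∈ S, ‖fderiv ℝ F u‖ ≤ K)
    (hL : ∀ u ∈ S, ∀ w ∈ S, ‖fderiv ℝ F u - fderiv ℝ F w‖ ≤ L * ‖u - w‖)
    {x₀ v h : E} {y z : ℝ → G} (hv : ‖v‖ ≤ 1) (hKv : K * ‖v‖ ≤ 1) (h0 : y 0 = z 0)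
    (hyS : ∀ t ∈ Icc (0 : ℝ) 1, (x₀ + t • v, y t) ∈ S)
    (hzS : ∀ t ∈ Icc (0 : ℝ) 1, (x₀ + t • (v + h), z t) ∈ S)
    (hy : ∀ t ∈ Icc (0 : ℝ) 1, HasDerivWithinAt y (F (x₀ + t • v, y t) v) (Icc 0 1) t)
    (hz : ∀ t ∈ Icc (0 : ℝ) 1,
      HasDerivWithinAt z (F (x₀ + t • (v + h), z t) (v + h)) (Icc 0 1) t) :
    ‖z 1 - y 1 - F (x₀ + v, y 1) h‖ ≤
      2 * (L * (3 + 2 * M) ^ 2 + K * (3 + 2 * M)) * ‖h‖ ^ 2 := by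
  have hM0 : 0 ≤ M := (norm_nonneg _).trans (hM _ (hyS 0 (by simp)))
  set u : ℝ → E × G := fun t ↦ (x₀ + t • v, y t) with hu
  set q : ℝ → E × G := fun t ↦ (x₀ + t • (v + h), z t) with hq
  have hqu : ∀ t, q t - u t = (t • h, z t - y t) := fun t ↦ by
    simp only [hu, hq, Prod.mk_sub_mk, smul_add]
    congr 1
    abel
  have hqu_le : ∀ t ∈ Icc (0 : ℝ) 1, ‖q t - u t‖ ≤ ‖h‖ + ‖z t - y t‖ := by
    intro t ht
    rw [hqu, Prod.norm_def]
    refine max_le ?_ (by simp)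
    simp only [norm_smul, Real.norm_eq_abs, abs_of_nonneg ht.1]
    nlinarith [norm_nonneg h, norm_nonneg (z t - y t), ht.2]
  have hlip : ∀ t ∈ Icc (0 : ℝ) 1, ‖F (q t) - F (u t)‖ ≤ K * ‖q t - u t‖ := fun t ht ↦
    hS.norm_image_sub_le_of_norm_fderiv_le hd hK (hyS t ht) (hzS t ht)
  have hδ : ∀ t ∈ Icc (0 : ℝ) 1, ‖z t - y t‖ ≤ 2 * ((1 + M) * ‖h‖) := by
    refine norm_le_two_mul_of_norm_deriv_le_norm_add (f := fun t ↦ z t - y t) (by positivity)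
      (fun t ht ↦ (hz t ht).sub (hy t ht)) (by simp [h0]) fun t ht ↦ ?_
    have e : F (q t) (v + h) - F (u t) v = (F (q t) - F (u t)) v + F (q t) h := by
      rw [map_add, sub_apply]
      abel
    have h1 := (F (q t) - F (u t)).le_of_opNorm_le (hlip t ht) v
    have h2 := (F (q t)).le_of_opNorm_le (hM _ (hzS t ht)) h
    change ‖F (q t) (v + h) - F (u t) v‖ ≤ _
    rw [e]
    refine (norm_add_le _ _).trans ?_
    have h3 : K * ‖q t - u t‖ * ‖v‖ ≤ ‖q t - u t‖ := by
      nlinarith [norm_nonneg (q t - u t)]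
    linarith [hqu_le t ht]
  have hΔ : ∀ t ∈ Icc (0 : ℝ) 1, ‖q t - u t‖ ≤ (3 + 2 * M) * ‖h‖ := fun t ht ↦ by
    linarith [hqu_le t ht, hδ t ht]
  have htaylor : ∀ t ∈ Icc (0 : ℝ) 1,
      ‖F (q t) - F (u t) - fderiv ℝ F (u t) (q t - u t)‖ ≤ L * ‖q t - u t‖ * ‖q t - u t‖ := by
    intro t ht
    have hseg : segment ℝ (u t) (q t) ⊆ S := hS.segment_subset (hyS t ht) (hzS t ht)
    refine (convex_segment (u t) (q t)).norm_image_sub_le_of_norm_fderiv_le'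
      (fun w hw ↦ hd w (hseg hw)) (fun w hw ↦ ?_) (left_mem_segment ..) (right_mem_segment ..)
    refine (hL w (hseg hw) _ (hyS t ht)).trans ?_
    gcongr
    exact norm_sub_le_of_mem_segment hw
  have hder : ∀ t ∈ Icc (0 : ℝ) 1, HasDerivWithinAt (fun t ↦ z t - y t - t • F (u t) h)
      (F (q t) (v + h) - F (u t) v -
        (t • fderiv ℝ F (u t) (v, F (u t) v) h + (1 : ℝ) • F (u t) h)) (Icc 0 1) t := by
    intro t ht
    have hut : HasDerivWithinAt u (v, F (u t) v) (Icc 0 1) t := by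
      refine HasDerivWithinAt.prodMk ?_ (hy t ht)
      simpa using ((hasDerivAt_id t).smul_const v |>.const_add x₀).hasDerivWithinAt
    have hFu := (hd _ (hyS t ht)).hasFDerivAt.comp_hasDerivWithinAt t hut
    have hFh := hFu.clm_apply (hasDerivWithinAt_const t (Icc 0 1) h)
    simp only [map_zero, add_zero] at hFh
    exact ((hz t ht).sub (hy t ht)).sub ((hasDerivWithinAt_id t _).smul hFh)
  have key := norm_le_two_mul_of_norm_deriv_le_norm_add
    (ε := (L * (3 + 2 * M) ^ 2 + K * (3 + 2 * M)) * ‖h‖ ^ 2) (by positivity) hder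
    (by simp [h0]) (fun t ht ↦ ?_) 1 (by simp)
  · simpa [hu, mul_assoc] using key
  · set w := z t - y t - t • F (u t) h with hw
    have e : F (q t) (v + h) - F (u t) v -
          (t • fderiv ℝ F (u t) (v, F (u t) v) h + (1 : ℝ) • F (u t) h) =
        fderiv ℝ F (u t) (0, w) v
          + (F (q t) - F (u t) - fderiv ℝ F (u t) (q t - u t)) v + (F (q t) - F (u t)) h := by
      have e1 : q t - u t = t • (h, F (u t) h) + (0, w) := by
        rw [hqu, hw]; simp
      rw [← hint _ (hyS t ht), e1]
      simp only [map_add, map_smul, sub_apply, add_apply,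
        smul_apply, one_smul]
      abel
    rw [e]
    refine (norm_add₃_le).trans ?_
    have h1 : ‖fderiv ℝ F (u t) (0, w) v‖ ≤ ‖w‖ := by
      have h1a := (fderiv ℝ F (u t)).le_of_opNorm_le (hK _ (hyS t ht)) (0, w)
      have h1b := (fderiv ℝ F (u t) (0, w)).le_of_opNorm_le h1a v
      have : ‖((0 : E), w)‖ = ‖w‖ := by simp [Prod.norm_def]
      rw [this] at h1b
      nlinarith [norm_nonneg w]
    have hsq : ‖q t - u t‖ * ‖q t - u t‖ ≤ ((3 + 2 * M) * ‖h‖) * ((3 + 2 * M) * ‖h‖) :=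
      mul_self_le_mul_self (norm_nonneg _) (hΔ t ht)
    have h2 : ‖(F (q t) - F (u t) - fderiv ℝ F (u t) (q t - u t)) v‖ ≤
        L * (3 + 2 * M) ^ 2 * ‖h‖ ^ 2 := by
      refine (ContinuousLinearMap.le_opNorm _ v).trans ?_
      refine (mul_le_of_le_one_right (norm_nonneg _) hv).trans ((htaylor t ht).trans ?_)
      nlinarith
    have h3 : ‖(F (q t) - F (u t)) h‖ ≤ K * (3 + 2 * M) * ‖h‖ ^ 2 := by
      refine ((F (q t) - F (u t)).le_of_opNorm_le (hlip t ht) h).trans ?_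
      have := mul_le_mul_of_nonneg_left (hΔ t ht) hK0
      nlinarith [norm_nonneg h]
    linarith

/-- Solutions of `dθ = F (x, θ)` inherit the smoothness of `F`. -/
theorem contDiffOn_of_hasFDerivAt_eq {F : E × G → E →L[ℝ] G} {W : Set (E × G)}
    (hF : ContDiffOn ℝ ∞ F W) {U : Set E} (hU : IsOpen U) {θ : E → G}
    (hθ : ∀ x ∈ U, (x, θ x) ∈ W ∧ HasFDerivAt θ (F (x, θ x)) x) : ContDiffOn ℝ ∞ θ U := by
  rw [contDiffOn_infty]
  intro n
  induction n with
  | zero =>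
    exact contDiffOn_zero.2 fun x hx ↦ (hθ x hx).2.continuousAt.continuousWithinAt
  | succ n ih =>
    push_cast
    rw [contDiffOn_succ_iff_fderiv_of_isOpen hU]
    refine ⟨fun x hx ↦ (hθ x hx).2.differentiableAt.differentiableWithinAt, by simp, ?_⟩
    refine ContDiffOn.congr ?_ fun x hx ↦ (hθ x hx).2.fderiv
    exact (hF.of_le (by exact_mod_cast le_top)).comp (contDiffOn_id.prodMk ih)
      fun x hx ↦ (hθ x hx).1

/-- Frobenius' theorem for total differential equations: if the integrability condition holds,
`dθ = F (x, θ)` has a smooth local solution with prescribed value at a point. -/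
theorem exists_contDiffOn_hasFDerivAt_eq [CompleteSpace G] {F : E × G → E →L[ℝ] G}
    {W : Set (E × G)} (hW : IsOpen W) (hF : ContDiffOn ℝ ∞ F W)
    (hint : ∀ u ∈ W, ∀ h v, fderiv ℝ F u (h, F u h) v = fderiv ℝ F u (v, F u v) h)
    {x₀ : E} {y₀ : G} (h₀ : (x₀, y₀) ∈ W) :
    ∃ (U : Set E) (θ : E → G), IsOpen U ∧ x₀ ∈ U ∧ θ x₀ = y₀ ∧ ContDiffOn ℝ ∞ θ U ∧
      ∀ x ∈ U, (x, θ x) ∈ W ∧ HasFDerivAt θ (F (x, θ x)) x := by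
  have hFat : ContDiffAt ℝ ∞ F (x₀, y₀) := hF.contDiffAt (hW.mem_nhds h₀)
  have hF'at : ContDiffAt ℝ 1 (fderiv ℝ F) (x₀, y₀) :=
    (hFat.fderiv_right (m := ∞) (by simp)).of_le (by simp)
  obtain ⟨L, T, hT, hLip⟩ := hF'at.exists_lipschitzOnWith
  set M := ‖F (x₀, y₀)‖ + 1
  set K := ‖fderiv ℝ F (x₀, y₀)‖ + 1
  have hM0 : 0 < M := by positivity
  have hK0 : 0 < K := by positivity
  have hMev : ∀ᶠ u in 𝓝 (x₀, y₀), ‖F u‖ < M :=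
    hFat.continuousAt.norm.eventually_lt_const (lt_add_one _)
  have hKev : ∀ᶠ u in 𝓝 (x₀, y₀), ‖fderiv ℝ F u‖ < K := by
    have hc : ContinuousAt (fderiv ℝ F) (x₀, y₀) := hF'at.continuousAt
    exact ((continuous_norm (E := E × G →L[ℝ] E →L[ℝ] G)).continuousAt.comp
      hc).eventually_lt_const (lt_add_one _)
  obtain ⟨R, hR, hball⟩ := Metric.eventually_nhds_iff_ball.1
    ((hMev.and hKev).and ((hW.eventually_mem h₀).and hT))
  set S := ball (x₀, y₀) R with hSdef
  have hS : Convex ℝ S := convex_ball _ _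
  have hd : ∀ u ∈ S, DifferentiableAt ℝ F u := fun u hu ↦
    (hF.contDiffAt (hW.mem_nhds (hball u hu).2.1)).differentiableAt (by simp)
  have hMS : ∀ u ∈ S, ‖F u‖ ≤ M := fun u hu ↦ (hball u hu).1.1.le
  have hKS : ∀ u ∈ S, ‖fderiv ℝ F u‖ ≤ K := fun u hu ↦ (hball u hu).1.2.le
  have hLS : ∀ u ∈ S, ∀ w ∈ S, ‖fderiv ℝ F u - fderiv ℝ F w‖ ≤ L * ‖u - w‖ :=
    fun u hu w hw ↦ hLip.norm_sub_le (hball u hu).2.2 (hball w hw).2.2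
  set r := R / 2 with hr
  have hr0 : 0 < r := by positivity
  obtain ⟨ρ, hρ0, hρ1, hρr, hρM, hρK⟩ :
      ∃ ρ : ℝ, 0 < ρ ∧ ρ ≤ 1 ∧ ρ ≤ r ∧ M * ρ ≤ r ∧ K * ρ ≤ 1 := by
    refine ⟨min (min 1 r) (min (r / M) (1 / K)), by positivity, ?_, ?_, ?_, ?_⟩
    · exact (min_le_left _ _).trans (min_le_left _ _)
    · exact (min_le_left _ _).trans (min_le_right _ _)
    · rw [mul_comm, ← le_div_iff₀ hM0]
      exact (min_le_right _ _).trans (min_le_left _ _)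
    · rw [mul_comm, ← le_div_iff₀ hK0]
      exact (min_le_right _ _).trans (min_le_right _ _)
  have hmemS : ∀ v : E, ‖v‖ < ρ → ∀ t ∈ Icc (0 : ℝ) 1, ∀ y ∈ closedBall y₀ r,
      (x₀ + t • v, y) ∈ S := by
    intro v hv t ht y hy
    rw [mem_closedBall] at hy
    rw [hSdef, mem_ball, Prod.dist_eq, max_lt_iff]
    refine ⟨?_, by dsimp only; linarith⟩
    simp only [dist_self_add_left, norm_smul, Real.norm_eq_abs, abs_of_nonneg ht.1]
    nlinarith [norm_nonneg v, ht.2]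
  have hsol : ∀ v : E, ‖v‖ < ρ → ∃ y : ℝ → G, y 0 = y₀ ∧ ∀ t ∈ Icc (0 : ℝ) 1,
      y t ∈ closedBall y₀ r ∧
        HasDerivWithinAt y (F (x₀ + t • v, y t) v) (Icc 0 1) t := by
    intro v hv
    have hPL : IsPicardLindelof (fun t y ↦ F (x₀ + t • v, y) v)
        (⟨0, by simp⟩ : Icc (0 : ℝ) 1) y₀ (.mk r hr0.le) 0 (.mk (M * ρ) (by positivity)) 1 :=
      { lipschitzOnWith := fun t ht ↦ by
          refine LipschitzOnWith.of_dist_le_mul fun y hy y' hy' ↦ ?_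
          have h1 := hS.norm_image_sub_le_of_norm_fderiv_le hd hKS
            (hmemS v hv t ht y' hy') (hmemS v hv t ht y hy)
          have h2 := ContinuousLinearMap.le_of_opNorm_le _ h1 v
          have h3 : ‖(x₀ + t • v, y) - (x₀ + t • v, y')‖ = ‖y - y'‖ := by
            simp [Prod.norm_def]
          rw [h3, sub_apply] at h2
          rw [dist_eq_norm, dist_eq_norm, NNReal.coe_one, one_mul]
          have h4 : K * ‖v‖ ≤ 1 := (mul_le_mul_of_nonneg_left hv.le hK0.le).trans hρK
          nlinarith [norm_nonneg (y - y')]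
        continuousOn := fun y hy t ht ↦ by
          have h1 : ContinuousAt (fun t : ℝ ↦ F (x₀ + t • v, y)) t :=
            ContinuousAt.comp (f := fun t : ℝ ↦ (x₀ + t • v, y))
              (hd _ (hmemS v hv t ht y hy)).continuousAt (by fun_prop)
          exact (h1.clm_apply continuousAt_const).continuousWithinAt
        norm_le := fun t ht y hy ↦ by
          refine (ContinuousLinearMap.le_of_opNorm_le _ (hMS _ (hmemS v hv t ht y hy)) v).trans ?_
          exact mul_le_mul_of_nonneg_left hv.le hM0.le
        mul_max_le := by simpa using hρM }
    exact hPL.exists_mem_closedBall_hasDerivWithinAt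
  choose! Y hY0 hY using hsol
  have hθW : ∀ x ∈ ball x₀ ρ, (x, Y (x - x₀) 1) ∈ W := by
    intro x hx
    rw [mem_ball_iff_norm] at hx
    have := hmemS _ hx 1 (by simp) _ (hY _ hx 1 (by simp)).1
    simpa using (hball _ this).2.1
  have hθ : ∀ x ∈ ball x₀ ρ, HasFDerivAt (fun x ↦ Y (x - x₀) 1) (F (x, Y (x - x₀) 1)) x := by
    intro x hx
    have hxv : ‖x - x₀‖ < ρ := mem_ball_iff_norm.1 hx
    refine HasFDerivAt.of_isLittleO ?_
    refine Asymptotics.IsBigO.trans_isLittleO (g := fun x' ↦ ‖x' - x‖ ^ 2) ?_ ?_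
    · refine Asymptotics.IsBigO.of_bound
        (2 * (L * (3 + 2 * M) ^ 2 + K * (3 + 2 * M))) ?_
      filter_upwards [isOpen_ball.mem_nhds hx] with x' hx'
      have hxv' : ‖x - x₀ + (x' - x)‖ < ρ := by
        rw [show x - x₀ + (x' - x) = x' - x₀ by abel]
        exact mem_ball_iff_norm.1 hx'
      have := norm_radial_solution_sub_le hS hd (fun u hu ↦ hint u (hball u hu).2.1)
        hK0.le L.2 hMS hKS hLS (x₀ := x₀) (v := x - x₀) (h := x' - x)
        (hxv.le.trans hρ1) ((mul_le_mul_of_nonneg_left hxv.le hK0.le).trans hρK)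
        ((hY0 _ hxv).trans (hY0 _ hxv').symm)
        (fun t ht ↦ hmemS _ hxv t ht _ (hY _ hxv t ht).1)
        (fun t ht ↦ hmemS _ hxv' t ht _ (hY _ hxv' t ht).1)
        (fun t ht ↦ (hY _ hxv t ht).2) (fun t ht ↦ (hY _ hxv' t ht).2)
      rw [show x - x₀ + (x' - x) = x' - x₀ by abel, add_sub_cancel] at this
      simpa using this
    · have h1 : Tendsto (fun x' ↦ x' - x) (𝓝 x) (𝓝 0) := by
        simpa using (continuous_id.sub continuous_const).tendsto (f := fun x' : E ↦ x' - x) x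
      exact (Asymptotics.isLittleO_norm_pow_id one_lt_two).comp_tendsto h1
  refine ⟨ball x₀ ρ, fun x ↦ Y (x - x₀) 1, isOpen_ball, mem_ball_self hρ0, ?_,
    contDiffOn_of_hasFDerivAt_eq hF isOpen_ball fun x hx ↦ ⟨hθW x hx, hθ x hx⟩,
    fun x hx ↦ ⟨hθW x hx, hθ x hx⟩⟩
  have h0 : ‖(0 : E)‖ < ρ := by simpa using hρ0
  have := norm_le_two_mul_of_norm_deriv_le_norm_add (f := fun t ↦ Y 0 t - y₀) (f' := 0) le_rfl
    (fun t ht ↦ by simpa using (hY 0 h0 t ht).2.sub_const y₀) (by simp [hY0 0 h0])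
    (by simp) 1 (by simp)
  simpa [sub_eq_zero] using this

end Frobenius

section Pfaffian

variable {m : ℕ}

/-- The linear form `v ↦ ∑ A, w A * v A` attached to the coefficient vector `w`. -/
noncomputable def coeffForm (m : ℕ) : (Fin m → ℝ) →L[ℝ] (Fin m → ℝ) →L[ℝ] ℝ :=
  ∑ A : Fin m, (ContinuousLinearMap.proj (R := ℝ) (φ := fun _ : Fin m ↦ ℝ) A).smulRight
    (ContinuousLinearMap.proj (R := ℝ) (φ := fun _ : Fin m ↦ ℝ) A)

theorem coeffForm_apply (w v : Fin m → ℝ) : coeffForm m w v = ∑ A, w A * v A := by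
  simp [coeffForm]

theorem coeffForm_single (w : Fin m → ℝ) (A : Fin m) :
    coeffForm m w (Pi.single A 1) = w A := by
  simp [coeffForm_apply, Pi.single_apply]

/-- If the exterior derivative of the one-form `Θ` is the wedge product of `α` and `β` in
coordinates, then it is so as an alternating bilinear map. -/
theorem coeffForm_fderiv_sub_eq {Θ : (Fin m → ℝ) → Fin m → ℝ} {x α β : Fin m → ℝ}
    (hd : DifferentiableAt ℝ Θ x)
    (h : ∀ A B, pd A (fun q ↦ Θ q B) x - pd B (fun q ↦ Θ q A) x = α A * β B - α B * β A)
    (v w : Fin m → ℝ) :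
    coeffForm m (fderiv ℝ Θ x v) w - coeffForm m (fderiv ℝ Θ x w) v =
      coeffForm m α v * coeffForm m β w - coeffForm m α w * coeffForm m β v := by
  have hpd : ∀ A B, pd A (fun q ↦ Θ q B) x = fderiv ℝ Θ x (Pi.single A 1) B := fun A B ↦ by
    rw [pd, fderiv_apply hd]
    rfl
  have hexp : ∀ v w, coeffForm m (fderiv ℝ Θ x v) w =
      ∑ A, ∑ B, v A * w B * pd A (fun q ↦ Θ q B) x := by
    intro v w
    conv_lhs => rw [← Finset.univ_sum_single v]
    have hs : ∀ A, Pi.single A (v A) = v A • (Pi.single A 1 : Fin m → ℝ) := fun A ↦ by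
      rw [← Pi.single_smul]; simp
    simp only [hs, map_sum, map_smul, sum_apply,
      smul_apply, coeffForm_apply, hpd, smul_eq_mul, Finset.mul_sum]
    exact Finset.sum_congr rfl fun A _ ↦ Finset.sum_congr rfl fun B _ ↦ by ring
  rw [hexp v w, hexp w v, Finset.sum_comm (f := fun A B ↦ w A * v B * _),
    ← Finset.sum_sub_distrib, mul_comm (coeffForm m α w)]
  simp only [coeffForm_apply, Finset.sum_mul_sum, ← Finset.sum_sub_distrib]
  refine Finset.sum_congr rfl fun A _ ↦ Finset.sum_congr rfl fun B _ ↦ ?_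
  linear_combination v A * w B * h A B

/-- The derivative of the right-hand side of the Pfaffian system, as a function of the base point
and of the angle. -/
theorem fderiv_coeffForm_rotation {Θ1 Θ2 Θ3 : (Fin m → ℝ) → Fin m → ℝ} {u : (Fin m → ℝ) × ℝ}
    (h1 : DifferentiableAt ℝ Θ1 u.1) (h2 : DifferentiableAt ℝ Θ2 u.1)
    (h3 : DifferentiableAt ℝ Θ3 u.1) (v w : Fin m → ℝ) (k : ℝ) :
    fderiv ℝ (fun u : (Fin m → ℝ) × ℝ ↦
        coeffForm m (Real.cos u.2 • Θ1 u.1 + Real.sin u.2 • Θ2 u.1 - Θ3 u.1)) u (v, k) w =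
      Real.cos u.2 * coeffForm m (fderiv ℝ Θ1 u.1 v) w
        - k * Real.sin u.2 * coeffForm m (Θ1 u.1) w
        + (Real.sin u.2 * coeffForm m (fderiv ℝ Θ2 u.1 v) w
          + k * Real.cos u.2 * coeffForm m (Θ2 u.1) w)
        - coeffForm m (fderiv ℝ Θ3 u.1 v) w := by
  have hs : HasFDerivAt (fun u : (Fin m → ℝ) × ℝ ↦ u.2) (.snd ℝ _ ℝ) u := hasFDerivAt_snd
  have hf : HasFDerivAt (fun u : (Fin m → ℝ) × ℝ ↦ u.1) (.fst ℝ _ ℝ) u := hasFDerivAt_fst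
  have H := (coeffForm m).hasFDerivAt.comp u
    (((hs.cos.smul (h1.hasFDerivAt.comp u hf)).add
      (hs.sin.smul (h2.hasFDerivAt.comp u hf))).sub (h3.hasFDerivAt.comp u hf))
  have H' := congrArg (fun D ↦ D (v, k) w) H.fderiv
  refine H'.trans ?_
  simp
  ring

end Pfaffian

/-- the Pfaffian system `dθ = Θ¹ cos θ + Θ² sin θ − Θ³` associated with a triple
of one-forms satisfying the structure equations is completely integrable: local solutions
exist with arbitrary initial value. -/
theorem pfaffian_system_completely_integrable
    (m : ℕ) (hm : 2 ≤ m)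
    (V : Set (Fin m → ℝ)) (hV : IsOpen V)
    (Θ1 Θ2 Θ3 : (Fin m → ℝ) → Fin m → ℝ)
    (hΘ1 : ContDiffOn ℝ (⊤ : ℕ∞) Θ1 V) (hΘ2 : ContDiffOn ℝ (⊤ : ℕ∞) Θ2 V) (hΘ3 : ContDiffOn ℝ (⊤ : ℕ∞) Θ3 V)
    (hstruct : StructEqM V Θ1 Θ2 Θ3) :
    ∀ p ∈ V, ∀ θ₀ : ℝ,
      ∃ (U : Set (Fin m → ℝ)) (θ : (Fin m → ℝ) → ℝ),
        IsOpen U ∧ p ∈ U ∧ U ⊆ V ∧ ContDiffOn ℝ (⊤ : ℕ∞) θ U ∧ θ p = θ₀ ∧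
        ∀ q ∈ U, ∀ A : Fin m,
          pd A θ q = Θ1 q A * Real.cos (θ q) + Θ2 q A * Real.sin (θ q) - Θ3 q A := by
  intro p hp θ₀
  set F : (Fin m → ℝ) × ℝ → (Fin m → ℝ) →L[ℝ] ℝ := fun u ↦
    coeffForm m (Real.cos u.2 • Θ1 u.1 + Real.sin u.2 • Θ2 u.1 - Θ3 u.1) with hFdef
  have hfst : ContDiffOn ℝ (⊤ : ℕ∞) (fun u : (Fin m → ℝ) × ℝ ↦ u.1) (V ×ˢ Set.univ) :=
    contDiff_fst.contDiffOn
  have hmaps : Set.MapsTo (fun u : (Fin m → ℝ) × ℝ ↦ u.1) (V ×ˢ Set.univ) V := fun u hu ↦ hu.1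
  have hF : ContDiffOn ℝ (⊤ : ℕ∞) F (V ×ˢ Set.univ) :=
    (coeffForm m).contDiff.comp_contDiffOn
      ((((Real.contDiff_cos.comp contDiff_snd).contDiffOn.smul (hΘ1.comp hfst hmaps)).add
        ((Real.contDiff_sin.comp contDiff_snd).contDiffOn.smul (hΘ2.comp hfst hmaps))).sub
        (hΘ3.comp hfst hmaps))
  have hint : ∀ u ∈ V ×ˢ (Set.univ : Set ℝ), ∀ h v,
      fderiv ℝ F u (h, F u h) v = fderiv ℝ F u (v, F u v) h := by
    rintro u ⟨hu, -⟩ h v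
    have hd : ∀ {Θ : (Fin m → ℝ) → Fin m → ℝ}, ContDiffOn ℝ (⊤ : ℕ∞) Θ V →
        DifferentiableAt ℝ Θ u.1 := fun hΘ ↦
      (hΘ.contDiffAt (hV.mem_nhds hu)).differentiableAt (by simp)
    have e1 := coeffForm_fderiv_sub_eq (hd hΘ1) (fun A B ↦ (hstruct _ hu A B).1) h v
    have e2 := coeffForm_fderiv_sub_eq (hd hΘ2) (fun A B ↦ (hstruct _ hu A B).2.1) h v
    have e3 := coeffForm_fderiv_sub_eq (hd hΘ3) (fun A B ↦ (hstruct _ hu A B).2.2) h v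
    have eF : ∀ w, F u w = Real.cos u.2 * coeffForm m (Θ1 u.1) w
        + Real.sin u.2 * coeffForm m (Θ2 u.1) w - coeffForm m (Θ3 u.1) w := fun w ↦ by
      simp [hFdef]
    rw [fderiv_coeffForm_rotation (hd hΘ1) (hd hΘ2) (hd hΘ3),
      fderiv_coeffForm_rotation (hd hΘ1) (hd hΘ2) (hd hΘ3), eF, eF]
    linear_combination Real.cos u.2 * e1 + Real.sin u.2 * e2 - e3
      + (coeffForm m (Θ1 u.1) h * coeffForm m (Θ2 u.1) v
        - coeffForm m (Θ1 u.1) v * coeffForm m (Θ2 u.1) h) * Real.sin_sq_add_cos_sq u.2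
  obtain ⟨U, θ, hU, hpU, hθp, hθ, hsol⟩ := exists_contDiffOn_hasFDerivAt_eq
    (hV.prod isOpen_univ) hF hint (x₀ := p) (y₀ := θ₀) ⟨hp, Set.mem_univ _⟩
  refine ⟨U, θ, hU, hpU, fun q hq ↦ (hsol q hq).1.1, hθ, hθp, fun q hq A ↦ ?_⟩
  rw [pd, (hsol q hq).2.fderiv, hFdef, coeffForm_single]
  simp only [Pi.sub_apply, Pi.add_apply, Pi.smul_apply, smul_eq_mul]
  ring
end

section
/- Let m ≥ 2, and let V, V̂ ⊆ ℝ^m be open sets. Let Θ¹, Θ², Θ³ : V → ℝ^m and Θ̂¹, Θ̂², Θ̂³ : V̂ → ℝ^m be smooth coefficient maps of one-forms, each triple satisfying the structure equations of a pseudo-spherical surface in m variables, and suppose Θ¹₀·Θ²₁ − Θ¹₁·Θ²₀ ≠ 0 everywhere on V and Θ̂¹₀·Θ̂²₁ − Θ̂¹₁·Θ̂²₀ ≠ 0 everywhere on V̂. Then for every p ∈ V and p̂ ∈ V̂ there exist open neighborhoods U ⊆ V of p and Û ⊆ V̂ of p̂, a diffeomorphism Υ : U → Û with Υ(p) = p̂,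 and a smooth function μ : U → ℝ, such that for every index A: (Υ*Θ̂¹)_A = Θ¹_A cos μ + Θ²_A sin μ, (Υ*Θ̂²)_A = −Θ¹_A sin μ + Θ²_A cos μ, and (Υ*Θ̂³)_A = Θ³_A + ∂_A μ, where (Υ*Θ̂)_A = Σ_B Θ̂_B(Υ(z))·∂_A Υ_B(z). -/
open Real

theorem add_smul_mem_ball {E : Type*} [NormedAddCommGroup E] [NormedSpace ℝ E] {p x : E} {r t : ℝ}
    (hx : ‖x‖ < r) (ht : t ∈ Set.Icc (0 : ℝ) 1) : p + t • x ∈ Metric.ball p r := by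
  rw [mem_ball_iff_norm, add_sub_cancel_left, norm_smul, Real.norm_of_nonneg ht.1]
  exact (mul_le_of_le_one_left (norm_nonneg x) ht.2).trans_lt hx

/-- If `F` is integrable in the sense of Frobenius, the function obtained by solving
`dμ = F(·, μ)` along every ray from `p` solves this total differential equation. -/
theorem hasFDerivAt_of_radial_solution {E : Type*} [NormedAddCommGroup E] [NormedSpace ℝ E]
    {F : E × ℝ → E →L[ℝ] ℝ} {p : E} {r : ℝ} {C K : NNReal}
    (hF : ContDiffOn ℝ 1 F (Metric.ball p r ×ˢ Set.univ))
    (hC : ∀ z ∈ Metric.ball p r, ∀ y, ‖F (z, y)‖ ≤ C)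
    (hK : ∀ z ∈ Metric.ball p r, LipschitzWith K fun y => F (z, y))
    (hint : ∀ z ∈ Metric.ball p r, ∀ y u v,
      fderiv ℝ F (z, y) (u, F (z, y) u) v = fderiv ℝ F (z, y) (v, F (z, y) v) u)
    {y₀ : ℝ} {γ : E → ℝ → ℝ} (hγ₀ : ∀ x, ‖x‖ < r → γ x 0 = y₀)
    (hγ : ∀ x, ‖x‖ < r → ∀ t ∈ Set.Icc (0 : ℝ) 1,
      HasDerivWithinAt (γ x) (F (p + t • x, γ x t) x) (Set.Icc 0 1) t)
    {x : E} (hx : ‖x‖ < r) :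
    HasFDerivAt (fun x => γ x 1) (F (p + x, γ x 1)) x := by
  have hr : 0 < r := (norm_nonneg x).trans_lt hx
  have hray : ∀ x : E, ‖x‖ < r → ∀ t ∈ Set.Icc (0 : ℝ) 1, p + t • x ∈ Metric.ball p r :=
    fun x hx t ht => add_smul_mem_ball hx ht
  set D : Set (E × ℝ) := Metric.ball p r ×ˢ Set.univ with hD
  have hDo : IsOpen D := Metric.isOpen_ball.prod isOpen_univ
  have hDc : Convex ℝ D := (convex_ball p r).prod convex_univ
  set c : ℝ → E × ℝ := fun t => (p + t • x, γ x t) with hc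
  have hcD : ∀ t ∈ Set.Icc (0 : ℝ) 1, c t ∈ D := fun t ht => ⟨hray x hx t ht, trivial⟩
  have hc' : ∀ t ∈ Set.Icc (0 : ℝ) 1,
      HasDerivWithinAt c (x, F (c t) x) (Set.Icc 0 1) t := by
    intro t ht
    have h1 : HasDerivWithinAt (fun t : ℝ => p + t • x) x (Set.Icc 0 1) t := by
      simpa using (((hasDerivAt_id t).smul_const x).const_add p).hasDerivWithinAt
    exact h1.prodMk (hγ x hx t ht)
  set S : Set (E × ℝ) := c '' Set.Icc 0 1 with hS
  have hSc : IsCompact S := isCompact_Icc.image_of_continuousOn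
    fun t ht => (hc' t ht).continuousWithinAt
  have hSD : S ⊆ D := by rintro _ ⟨t, ht, rfl⟩; exact hcD t ht
  have hdF : ∀ a ∈ D, HasFDerivAt F (fderiv ℝ F a) a := fun a ha =>
    ((hF.differentiableOn one_ne_zero).differentiableAt (hDo.mem_nhds ha)).hasFDerivAt
  have hcont : ∀ a ∈ S, ContinuousAt (fderiv ℝ F) a := fun a ha =>
    (hF.continuousOn_fderiv_of_isOpen hDo le_rfl).continuousAt (hDo.mem_nhds (hSD ha))
  obtain ⟨M, hM⟩ := hSc.exists_bound_of_continuousOn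
    (f := fderiv ℝ F) (fun a ha => (hcont a ha).continuousWithinAt)
  have hM0 : 0 ≤ M := (norm_nonneg _).trans (hM (c 0) ⟨0, by simp, rfl⟩)
  set L : NNReal := K * r.toNNReal with hL
  set G := gronwallBound 0 L 1 1 with hG
  have hG0 : 0 ≤ G := by
    have := gronwallBound_mono (δ := 0) (ε := 1) (K := L) le_rfl zero_le_one L.2 zero_le_one
    rwa [gronwallBound_x0] at this
  have hGlin : ∀ ε, gronwallBound 0 L ε 1 = ε * G := by
    intro ε
    simp only [hG, gronwallBound]
    split_ifs <;> ring
  refine .of_isLittleO ?_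
  rw [Asymptotics.isLittleO_iff]
  intro ε hε
  set N : ℝ := (1 + C) * (M + r) * G + 1 with hN
  have hN0 : 0 < N := by positivity
  set η := ε / N with hη
  have hη0 : 0 < η := div_pos hε hN0
  have hunif : {q : (E × ℝ →L[ℝ] E →L[ℝ] ℝ) × (E × ℝ →L[ℝ] E →L[ℝ] ℝ) | dist q.1 q.2 < η}
      ∈ uniformity (E × ℝ →L[ℝ] E →L[ℝ] ℝ) :=
    Metric.dist_mem_uniformity (α := E × ℝ →L[ℝ] E →L[ℝ] ℝ) hη0
  obtain ⟨δ, hδ0, hδ⟩ := Metric.mem_uniformity_dist.1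
    (hSc.uniformContinuousAt_of_continuousAt (fderiv ℝ F) hcont hunif)
  have hev : ∀ᶠ x' in nhds x, ‖x' - x‖ < min (min η (δ / (1 + C))) (r - ‖x‖) := by
    have hpos : 0 < min (min η (δ / (1 + C))) (r - ‖x‖) :=
      lt_min (lt_min hη0 (by positivity)) (sub_pos.2 hx)
    filter_upwards [Metric.ball_mem_nhds x hpos] with x' hx'
    rwa [mem_ball_iff_norm] at hx'
  filter_upwards [hev] with x' hx'
  obtain ⟨h, rfl⟩ : ∃ h, x' = x + h := ⟨x' - x, by abel⟩
  simp only [add_sub_cancel_left, lt_min_iff] at hx' ⊢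
  obtain ⟨⟨hhη, hhδ⟩, hhr⟩ := hx'
  have hxh : ‖x + h‖ < r := (norm_add_le x h).trans_lt (by linarith)
  rw [lt_div_iff₀ (by positivity)] at hhδ
  set w : ℝ → ℝ := fun t => γ x t + t * F (c t) h with hw
  have hFc : ∀ t ∈ Set.Icc (0 : ℝ) 1, ‖(h, F (c t) h)‖ ≤ (1 + C) * ‖h‖ := by
    intro t ht
    have h1 : ‖F (c t) h‖ ≤ C * ‖h‖ :=
      (F (c t)).le_of_opNorm_le (hC _ (hray x hx t ht) _) h
    refine (Prod.norm_def _).trans_le (max_le ?_ (h1.trans ?_)) <;>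
      nlinarith [norm_nonneg h, C.2, mul_nonneg C.2 (norm_nonneg h)]
  have hw' : ∀ t ∈ Set.Icc (0 : ℝ) 1, HasDerivWithinAt w
      (F (c t) x + (F (c t) h + t * fderiv ℝ F (c t) (x, F (c t) x) h)) (Set.Icc 0 1) t := by
    intro t ht
    have h1 := ((hdF _ (hcD t ht)).comp_hasDerivWithinAt t (hc' t ht)).clm_apply
      (hasDerivWithinAt_const t _ h)
    have h2 := (hγ x hx t ht).add ((hasDerivWithinAt_id t (Set.Icc 0 1)).mul h1)
    convert! h2 using 1
    simp [hc]
  have htaylor : ∀ t ∈ Set.Icc (0 : ℝ) 1,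
      ‖F (c t + t • (h, F (c t) h)) - F (c t) - fderiv ℝ F (c t) (t • (h, F (c t) h))‖
        ≤ η * ((1 + C) * ‖h‖) := by
    intro t ht
    have hk : ‖t • (h, F (c t) h)‖ ≤ (1 + C) * ‖h‖ := by
      rw [norm_smul, Real.norm_of_nonneg ht.1]
      exact (mul_le_of_le_one_left (norm_nonneg _) ht.2).trans (hFc t ht)
    have hmem : c t + t • (h, F (c t) h) ∈ D := by
      refine ⟨?_, trivial⟩
      convert! hray _ hxh t ht using 1
      simp [hc, add_assoc]
    have := (hDc.inter (convex_ball (c t) δ)).norm_image_sub_le_of_norm_hasFDerivWithin_le'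
      (f := F) (f' := fderiv ℝ F) (φ := fderiv ℝ F (c t)) (C := η)
      (fun a ha => (hdF a ha.1).hasFDerivWithinAt)
      (fun a ha => by
        rw [← dist_eq_norm, dist_comm]
        exact (hδ (by rw [dist_comm]; exact ha.2) ⟨t, ht, rfl⟩).le)
      ⟨hcD t ht, Metric.mem_ball_self hδ0⟩
      (y := c t + t • (h, F (c t) h))
      ⟨hmem, by
        rw [mem_ball_iff_norm, add_sub_cancel_left]
        linarith⟩
    rw [add_sub_cancel_left] at this
    exact this.trans (mul_le_mul_of_nonneg_left hk hη0.le)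
  have hres : ∀ t ∈ Set.Icc (0 : ℝ) 1,
      dist (F (c t) x + (F (c t) h + t * fderiv ℝ F (c t) (x, F (c t) x) h))
        (F (p + t • (x + h), w t) (x + h)) ≤ η * ((1 + C) * (M + r)) * ‖h‖ := by
    intro t ht
    have hpt : (p + t • (x + h), w t) = c t + t • (h, F (c t) h) := by
      simp [hc, hw, add_assoc]
    rw [hpt]
    set R := F (c t + t • (h, F (c t) h)) - F (c t) - fderiv ℝ F (c t) (t • (h, F (c t) h))
      with hR
    have hFR : F (c t + t • (h, F (c t) h))
        = R + F (c t) + t • fderiv ℝ F (c t) (h, F (c t) h) := by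
      rw [hR, map_smul]; abel
    have hsymm := hint _ (hray x hx t ht) (γ x t) x h
    have heq : F (c t) x + (F (c t) h + t * fderiv ℝ F (c t) (x, F (c t) x) h)
        - F (c t + t • (h, F (c t) h)) (x + h)
        = -(t * fderiv ℝ F (c t) (h, F (c t) h) h) - R (x + h) := by
      rw [hFR]
      simp only [add_apply, smul_apply, map_add,
        smul_eq_mul]
      linear_combination t * hsymm
    rw [dist_eq_norm, heq]
    have h1 : ‖fderiv ℝ F (c t) (h, F (c t) h) h‖ ≤ M * ((1 + C) * ‖h‖) * ‖h‖ :=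
      (fderiv ℝ F (c t) (h, F (c t) h)).le_of_opNorm_le
        ((fderiv ℝ F (c t)).le_of_opNorm_le_of_le (hM _ ⟨t, ht, rfl⟩) (hFc t ht)) h
    have h2 : ‖t * fderiv ℝ F (c t) (h, F (c t) h) h‖ ≤ M * ((1 + C) * ‖h‖) * ‖h‖ := by
      rw [norm_mul, Real.norm_of_nonneg ht.1]
      exact (mul_le_of_le_one_left (norm_nonneg _) ht.2).trans h1
    have h3 : ‖R (x + h)‖ ≤ η * ((1 + C) * ‖h‖) * r :=
      R.le_of_opNorm_le_of_le (htaylor t ht) hxh.le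
    have h4 : M * ((1 + C) * ‖h‖) * ‖h‖ ≤ M * ((1 + C) * ‖h‖) * η := by gcongr
    calc _ ≤ ‖t * fderiv ℝ F (c t) (h, F (c t) h) h‖ + ‖R (x + h)‖ := by
            simpa only [norm_neg] using norm_sub_le (-(t * fderiv ℝ F (c t) (h, F (c t) h) h)) _
      _ ≤ M * ((1 + C) * ‖h‖) * η + η * ((1 + C) * ‖h‖) * r := by linarith
      _ = _ := by ring
  have hIco : ∀ {f : ℝ → ℝ} {f' t : ℝ}, t ∈ Set.Ico (0 : ℝ) 1 →
      HasDerivWithinAt f f' (Set.Icc 0 1) t → HasDerivWithinAt f f' (Set.Ici t) t :=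
    fun ht h => h.mono_of_mem_nhdsWithin
      (Filter.mem_of_superset (Icc_mem_nhdsGE ht.2) (Set.Icc_subset_Icc_left ht.1))
  have hlip : ∀ t ∈ Set.Icc (0 : ℝ) 1,
      LipschitzWith L fun y => F (p + t • (x + h), y) (x + h) := by
    refine fun t ht => LipschitzWith.of_dist_le_mul fun y y' => ?_
    have h1 := (hK _ (hray _ hxh t ht)).dist_le_mul y y'
    rw [dist_eq_norm] at h1 ⊢
    rw [← sub_apply, hL, NNReal.coe_mul, Real.coe_toNNReal r hr.le]
    exact (ContinuousLinearMap.le_of_opNorm_le_of_le _ h1 hxh.le).trans_eq (by ring)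
  have hgron := dist_le_of_approx_trajectories_ODE_of_mem (a := 0) (b := 1) (K := L) (δ := 0)
    (v := fun t y => F (p + t • (x + h), y) (x + h)) (s := fun _ => Set.univ)
    (f := γ (x + h)) (g := w) (εf := 0)
    (f' := fun t => F (p + t • (x + h), γ (x + h) t) (x + h))
    (fun t ht => (hlip t ⟨ht.1, ht.2.le⟩).lipschitzOnWith)
    (fun t ht => (hγ _ hxh t ht).continuousWithinAt)
    (fun t ht => hIco ht (hγ _ hxh t ⟨ht.1, ht.2.le⟩))
    (fun t _ => (dist_self _).le) (fun _ _ => trivial)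
    (fun t ht => (hw' t ht).continuousWithinAt)
    (fun t ht => hIco ht (hw' t ⟨ht.1, ht.2.le⟩))
    (fun t ht => hres t ⟨ht.1, ht.2.le⟩) (fun _ _ => trivial)
    (by simp [hw, hγ₀ _ hx, hγ₀ _ hxh]) 1 (by simp)
  rw [zero_add, sub_zero, hGlin, dist_eq_norm] at hgron
  have hw1 : γ (x + h) 1 - γ x 1 - F (p + x, γ x 1) h = γ (x + h) 1 - w 1 := by
    simp [hw, hc, sub_sub]
  rw [hw1]
  refine hgron.trans ?_
  have hεN : ε = η * N := (div_mul_cancel₀ ε hN0.ne').symm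
  have : 0 ≤ η * ‖h‖ := by positivity
  calc _ = η * ‖h‖ * (N - 1) := by rw [hN]; ring
    _ ≤ ε * ‖h‖ := by rw [hεN]; linarith

/-- The scalar Frobenius theorem: an integrable total differential equation `dμ = F(z, μ)` with
bounded and uniformly Lipschitz right-hand side is solvable on a ball. -/
theorem exists_hasFDerivAt_of_integrable {E : Type*} [NormedAddCommGroup E] [NormedSpace ℝ E]
    {F : E × ℝ → E →L[ℝ] ℝ} {p : E} {r : ℝ} {C K : NNReal}
    (hF : ContDiffOn ℝ 1 F (Metric.ball p r ×ˢ Set.univ))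
    (hC : ∀ z ∈ Metric.ball p r, ∀ y, ‖F (z, y)‖ ≤ C)
    (hK : ∀ z ∈ Metric.ball p r, LipschitzWith K fun y => F (z, y))
    (hint : ∀ z ∈ Metric.ball p r, ∀ y u v,
      fderiv ℝ F (z, y) (u, F (z, y) u) v = fderiv ℝ F (z, y) (v, F (z, y) v) u) :
    ∃ μ : E → ℝ, ∀ z ∈ Metric.ball p r, HasFDerivAt μ (F (z, μ z)) z := by
  have hray : ∀ x : E, ‖x‖ < r → ∀ t ∈ Set.Icc (0 : ℝ) 1, p + t • x ∈ Metric.ball p r :=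
    fun x hx t ht => add_smul_mem_ball hx ht
  have hsol : ∀ x : E, ∃ γ : ℝ → ℝ, ‖x‖ < r → γ 0 = 0 ∧ ∀ t ∈ Set.Icc (0 : ℝ) 1,
      HasDerivWithinAt γ (F (p + t • x, γ t) x) (Set.Icc 0 1) t := by
    intro x
    by_cases hx : ‖x‖ < r
    swap
    · exact ⟨0, fun h => absurd h hx⟩
    have hPL : IsPicardLindelof (fun t y => F (p + t • x, y) x)
        (⟨0, by simp⟩ : Set.Icc (0 : ℝ) 1) (0 : ℝ) (C * ‖x‖₊) 0 (C * ‖x‖₊) (K * ‖x‖₊) := by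
      refine ⟨fun t ht => (LipschitzWith.of_dist_le_mul fun y y' => ?_).lipschitzOnWith, ?_, ?_,
        by simp⟩
      · have h1 := (hK _ (hray _ hx t ht)).dist_le_mul y y'
        rw [dist_eq_norm] at h1 ⊢
        rw [← sub_apply, NNReal.coe_mul]
        exact (ContinuousLinearMap.le_of_opNorm_le _ h1 x).trans_eq (by rw [coe_nnnorm]; ring)
      · intro y _
        refine ContinuousOn.clm_apply (hF.continuousOn.comp ?_ ?_) continuousOn_const
        · fun_prop
        · exact fun t ht => ⟨hray x hx t ht, trivial⟩
      · intro t ht y _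
        exact ContinuousLinearMap.le_of_opNorm_le _ (hC _ (hray x hx t ht) y) x
    obtain ⟨γ, h0, hγ⟩ := hPL.exists_eq_forall_mem_Icc_hasDerivWithinAt₀
    exact ⟨γ, fun _ => ⟨h0, hγ⟩⟩
  choose γ hγ using hsol
  refine ⟨fun z => γ (z - p) 1, fun z hz => ?_⟩
  rw [mem_ball_iff_norm] at hz
  have h1 := hasFDerivAt_of_radial_solution hF hC hK hint (fun x hx => (hγ x hx).1)
    (fun x hx => (hγ x hx).2) hz
  rw [add_sub_cancel] at h1
  have h2 := h1.comp z ((hasFDerivAt_id z).sub_const p)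
  rwa [ContinuousLinearMap.comp_id] at h2

/-- Solutions of a smooth total differential equation are smooth. -/
theorem contDiffOn_of_hasFDerivAt_eq_s13 {E : Type*} [NormedAddCommGroup E] [NormedSpace ℝ E]
    {F : E × ℝ → E →L[ℝ] ℝ} {U : Set E} (hU : IsOpen U)
    (hF : ContDiffOn ℝ (⊤ : ℕ∞) F (U ×ˢ Set.univ)) {μ : E → ℝ}
    (hμ : ∀ z ∈ U, HasFDerivAt μ (F (z, μ z)) z) : ContDiffOn ℝ (⊤ : ℕ∞) μ U := by
  rw [contDiffOn_infty]
  intro n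
  induction n with
  | zero =>
    exact contDiffOn_zero.2 fun z hz => (hμ z hz).continuousAt.continuousWithinAt
  | succ n ih =>
    rw [Nat.cast_succ, contDiffOn_succ_iff_fderiv_of_isOpen hU]
    refine ⟨fun z hz => (hμ z hz).differentiableAt.differentiableWithinAt, by simp, ?_⟩
    refine ContDiffOn.congr (f := fun z => F (z, μ z)) ?_ fun z hz => (hμ z hz).fderiv
    exact (contDiffOn_infty.1 hF n).comp (contDiffOn_id.prodMk ih) fun z hz => ⟨hz, trivial⟩

/-- A smooth closed one-form on a ball has a smooth primitive vanishing at the centre. -/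
theorem exists_primitive_of_closed {E : Type*} [NormedAddCommGroup E] [NormedSpace ℝ E]
    {ω : E → E →L[ℝ] ℝ} {p : E} {r : ℝ} (hω : ContDiffOn ℝ (⊤ : ℕ∞) ω (Metric.ball p r))
    (hclosed : ∀ z ∈ Metric.ball p r, ∀ u v, fderiv ℝ ω z u v = fderiv ℝ ω z v u) :
    ∃ f : E → ℝ, f p = 0 ∧ ContDiffOn ℝ (⊤ : ℕ∞) f (Metric.ball p r) ∧
      ∀ z ∈ Metric.ball p r, HasFDerivAt f (ω z) z := by
  obtain ⟨f, hf⟩ := (convex_ball p r).exists_forall_hasFDerivAt_of_fderiv_symmetric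
    Metric.isOpen_ball (hω.differentiableOn (by simp)) hclosed
  have hf' : ∀ z ∈ Metric.ball p r, HasFDerivAt (fun z => f z - f p) (ω z) z :=
    fun z hz => (hf z hz).sub_const _
  refine ⟨fun z => f z - f p, sub_self _, ?_, hf'⟩
  exact contDiffOn_of_hasFDerivAt_eq_s13 (F := fun a => ω a.1) Metric.isOpen_ball
    (hω.comp contDiffOn_fst fun a ha => ha.1) hf'

/-- Normal form of a pseudo-spherical coframe: after a gauge rotation by `θ` it becomes
`(e⁻ᵛ du, dv, e⁻ᵛ du)`. -/
theorem exists_horocyclic_normal_form {E : Type*} [NormedAddCommGroup E] [NormedSpace ℝ E]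
    {T₁ T₂ T₃ : E → E →L[ℝ] ℝ} {V : Set E} (hV : IsOpen V)
    (hT₁ : ContDiffOn ℝ (⊤ : ℕ∞) T₁ V) (hT₂ : ContDiffOn ℝ (⊤ : ℕ∞) T₂ V)
    (hT₃ : ContDiffOn ℝ (⊤ : ℕ∞) T₃ V)
    (h₁ : ∀ q ∈ V, ∀ a b, fderiv ℝ T₁ q a b - fderiv ℝ T₁ q b a
      = T₃ q a * T₂ q b - T₃ q b * T₂ q a)
    (h₂ : ∀ q ∈ V, ∀ a b, fderiv ℝ T₂ q a b - fderiv ℝ T₂ q b a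
      = T₁ q a * T₃ q b - T₁ q b * T₃ q a)
    (h₃ : ∀ q ∈ V, ∀ a b, fderiv ℝ T₃ q a b - fderiv ℝ T₃ q b a
      = T₁ q a * T₂ q b - T₁ q b * T₂ q a)
    {p : E} (hp : p ∈ V) :
    ∃ r > 0, Metric.ball p r ⊆ V ∧ ∃ θ u v : E → ℝ, u p = 0 ∧ v p = 0 ∧
      ContDiffOn ℝ (⊤ : ℕ∞) θ (Metric.ball p r) ∧ ContDiffOn ℝ (⊤ : ℕ∞) u (Metric.ball p r) ∧
      ContDiffOn ℝ (⊤ : ℕ∞) v (Metric.ball p r) ∧ ∀ q ∈ Metric.ball p r,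
        HasFDerivAt θ (cos (θ q) • T₁ q + sin (θ q) • T₂ q - T₃ q) q ∧
        HasFDerivAt v (cos (θ q) • T₂ q - sin (θ q) • T₁ q) q ∧
        HasFDerivAt u (exp (v q) • (cos (θ q) • T₁ q + sin (θ q) • T₂ q)) q := by
  have hbd : ∀ T : E → E →L[ℝ] ℝ, ContDiffOn ℝ (⊤ : ℕ∞) T V →
      ∀ᶠ q in nhds p, ‖T q‖₊ < ‖T p‖₊ + 1 := fun T hT =>
    (hT.continuousOn.continuousAt (hV.mem_nhds hp)).nnnorm.eventually_lt_const
      (lt_add_of_pos_right _ one_pos)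
  obtain ⟨r, hr, hball⟩ := Metric.eventually_nhds_iff_ball.1
    ((hbd T₁ hT₁).and ((hbd T₂ hT₂).and ((hbd T₃ hT₃).and (hV.mem_nhds hp))))
  have hBV : Metric.ball p r ⊆ V := fun q hq => (hball q hq).2.2.2
  have hd : ∀ {T : E → E →L[ℝ] ℝ}, ContDiffOn ℝ (⊤ : ℕ∞) T V → ∀ q ∈ Metric.ball p r,
      HasFDerivAt T (fderiv ℝ T q) q := fun hT q hq =>
    ((hT.differentiableOn (by simp)).differentiableAt (hV.mem_nhds (hBV hq))).hasFDerivAt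
  set F : E × ℝ → E →L[ℝ] ℝ :=
    fun a => cos a.2 • T₁ a.1 + sin a.2 • T₂ a.1 - T₃ a.1 with hFdef
  have hfst : ∀ {T : E → E →L[ℝ] ℝ}, ContDiffOn ℝ (⊤ : ℕ∞) T V →
      ContDiffOn ℝ (⊤ : ℕ∞) (fun a : E × ℝ => T a.1) (Metric.ball p r ×ˢ Set.univ) :=
    fun hT => hT.comp contDiffOn_fst fun a ha => hBV ha.1
  have hF : ContDiffOn ℝ (⊤ : ℕ∞) F (Metric.ball p r ×ˢ Set.univ) :=
    (((contDiff_cos.comp contDiff_snd).contDiffOn.smul (hfst hT₁)).add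
      ((contDiff_sin.comp contDiff_snd).contDiffOn.smul (hfst hT₂))).sub (hfst hT₃)
  have hF' : ∀ z ∈ Metric.ball p r, ∀ y s a b, fderiv ℝ F (z, y) (a, s) b =
      cos y * fderiv ℝ T₁ z a b + sin y * fderiv ℝ T₂ z a b - fderiv ℝ T₃ z a b
        + s * (cos y * T₂ z b - sin y * T₁ z b) := by
    intro z hz y s a b
    have e : ∀ {T : E → E →L[ℝ] ℝ}, ContDiffOn ℝ (⊤ : ℕ∞) T V → HasFDerivAt
        (fun a : E × ℝ => T a.1) ((fderiv ℝ T z).comp (ContinuousLinearMap.fst ℝ E ℝ)) (z, y) :=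
      fun hT => HasFDerivAt.comp (z, y) (hd hT z hz) hasFDerivAt_fst
    have hsnd : HasFDerivAt (fun a : E × ℝ => a.2) (ContinuousLinearMap.snd ℝ E ℝ) (z, y) :=
      hasFDerivAt_snd
    have := ((hsnd.cos.smul (e hT₁)).add (hsnd.sin.smul (e hT₂))).sub (e hT₃)
    rw [show fderiv ℝ F (z, y) = _ from this.fderiv]
    simp
    ring
  obtain ⟨θ, hθ⟩ := exists_hasFDerivAt_of_integrable (F := F)
    (C := (‖T₁ p‖₊ + 1) + (‖T₂ p‖₊ + 1) + (‖T₃ p‖₊ + 1))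
    (K := (‖T₁ p‖₊ + 1) + (‖T₂ p‖₊ + 1)) (hF.of_le (by exact_mod_cast le_top))
    (by
      intro z hz y
      obtain ⟨b1, b2, b3, -⟩ := hball z hz
      refine (norm_sub_le _ _).trans (add_le_add ((norm_add_le _ _).trans
        (add_le_add ?_ ?_)) b3.le)
      · rw [norm_smul]
        exact (mul_le_of_le_one_left (norm_nonneg _) (abs_cos_le_one _)).trans b1.le
      · rw [norm_smul]
        exact (mul_le_of_le_one_left (norm_nonneg _) (abs_sin_le_one _)).trans b2.le)
    (by
      intro z hz
      obtain ⟨b1, b2, -, -⟩ := hball z hz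
      refine LipschitzWith.of_dist_le_mul fun y y' => ?_
      rw [dist_eq_norm, hFdef]
      have : cos y • T₁ z + sin y • T₂ z - T₃ z - (cos y' • T₁ z + sin y' • T₂ z - T₃ z)
        = (cos y - cos y') • T₁ z + (sin y - sin y') • T₂ z := by module
      simp only [this]
      refine (norm_add_le _ _).trans ?_
      rw [norm_smul, norm_smul, NNReal.coe_add, add_mul, mul_comm _ (dist y y'),
        mul_comm _ (dist y y'), ← dist_eq_norm, ← dist_eq_norm]
      have hc : dist (cos y) (cos y') ≤ dist y y' := by
        simpa using lipschitzWith_cos.dist_le_mul y y'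
      have hs : dist (sin y) (sin y') ≤ dist y y' := by
        simpa using lipschitzWith_sin.dist_le_mul y y'
      exact add_le_add (mul_le_mul hc b1.le (norm_nonneg _) dist_nonneg)
        (mul_le_mul hs b2.le (norm_nonneg _) dist_nonneg))
    (by
      intro z hz y a b
      rw [hF' z hz, hF' z hz]
      have e1 := h₁ z (hBV hz) a b
      have e2 := h₂ z (hBV hz) a b
      have e3 := h₃ z (hBV hz) a b
      simp only [hFdef, sub_apply, add_apply, smul_apply, smul_eq_mul]
      linear_combination cos y * e1 + sin y * e2 - e3
        + (T₁ z a * T₂ z b - T₁ z b * T₂ z a) * sin_sq_add_cos_sq y)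
  have hθs := contDiffOn_of_hasFDerivAt_eq_s13 Metric.isOpen_ball hF hθ
  obtain ⟨v, hv0, hvs, hv⟩ := exists_primitive_of_closed (p := p) (r := r)
    (ω := fun q => cos (θ q) • T₂ q - sin (θ q) • T₁ q)
    ((hθs.cos.smul (hT₂.mono hBV)).sub (hθs.sin.smul (hT₁.mono hBV)))
    (by
      intro z hz a b
      have := ((hθ z hz).cos.smul (hd hT₂ z hz)).sub ((hθ z hz).sin.smul (hd hT₁ z hz))
      rw [show fderiv ℝ (fun q => cos (θ q) • T₂ q - sin (θ q) • T₁ q) z = _ from this.fderiv]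
      have e1 := h₁ z (hBV hz) a b
      have e2 := h₂ z (hBV hz) a b
      simp [hFdef]
      linear_combination cos (θ z) * e2 - sin (θ z) * e1)
  obtain ⟨u, hu0, hus, hu⟩ := exists_primitive_of_closed (p := p) (r := r)
    (ω := fun q => exp (v q) • (cos (θ q) • T₁ q + sin (θ q) • T₂ q))
    (hvs.exp.smul ((hθs.cos.smul (hT₁.mono hBV)).add (hθs.sin.smul (hT₂.mono hBV))))
    (by
      intro z hz a b
      have := (hv z hz).exp.smul
        (((hθ z hz).cos.smul (hd hT₁ z hz)).add ((hθ z hz).sin.smul (hd hT₂ z hz)))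
      rw [show fderiv ℝ (fun q => exp (v q) • (cos (θ q) • T₁ q + sin (θ q) • T₂ q)) z = _
        from this.fderiv]
      have e1 := h₁ z (hBV hz) a b
      have e2 := h₂ z (hBV hz) a b
      simp [hFdef]
      linear_combination exp (v z) * (cos (θ z) * e1 + sin (θ z) * e2))
  exact ⟨r, hr, hBV, θ, u, v, hu0, hv0, hθs, hus, hvs,
    fun q hq => ⟨hθ q hq, hv q hq, hu q hq⟩⟩

/-- The one-form with constant coefficients `a`. -/
noncomputable def coframeForm {m : ℕ} (a : Fin m → ℝ) : (Fin m → ℝ) →L[ℝ] ℝ :=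
  ∑ A, a A • ContinuousLinearMap.proj A

theorem coframeForm_apply {m : ℕ} (a w : Fin m → ℝ) : coframeForm a w = ∑ A, a A * w A := by
  simp [coframeForm]

theorem coframeForm_single {m : ℕ} (a : Fin m → ℝ) (A : Fin m) :
    coframeForm a (Pi.single A 1) = a A := by
  simp [coframeForm_apply, Pi.single_apply]

theorem contDiffOn_coframeForm {m : ℕ} {V : Set (Fin m → ℝ)} {Θ : (Fin m → ℝ) → Fin m → ℝ}
    (hΘ : ContDiffOn ℝ (⊤ : ℕ∞) Θ V) : ContDiffOn ℝ (⊤ : ℕ∞) (fun q => coframeForm (Θ q)) V :=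
  ContDiffOn.sum fun A _ => (contDiffOn_pi.1 hΘ A).smul contDiffOn_const

theorem fderiv_apply_eq_sum_pd {m : ℕ} (f : (Fin m → ℝ) → ℝ) (q a : Fin m → ℝ) :
    fderiv ℝ f q a = ∑ A, a A * pd A f q := by
  conv_lhs => rw [pi_eq_sum_univ' a, map_sum]
  simp only [map_smul, smul_eq_mul, pd]

theorem fderiv_coframeForm_apply {m : ℕ} {Θ : (Fin m → ℝ) → Fin m → ℝ} {q : Fin m → ℝ}
    (hΘ : DifferentiableAt ℝ Θ q) (a b : Fin m → ℝ) :
    fderiv ℝ (fun q => coframeForm (Θ q)) q a b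
      = ∑ A, ∑ B, a A * b B * pd A (fun q => Θ q B) q := by
  have h : HasFDerivAt (fun q => coframeForm (Θ q)) (∑ B, (fderiv ℝ (fun q => Θ q B) q).smulRight
      (ContinuousLinearMap.proj (R := ℝ) (φ := fun _ : Fin m => ℝ) B)) q :=
    HasFDerivAt.fun_sum fun B _ =>
      (differentiableAt_pi.1 hΘ B).hasFDerivAt.smul_const
        (ContinuousLinearMap.proj (R := ℝ) (φ := fun _ : Fin m => ℝ) B)
  rw [h.fderiv, Finset.sum_comm]
  simp only [sum_apply, ContinuousLinearMap.smulRight_apply, smul_apply,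
    ContinuousLinearMap.proj_apply, smul_eq_mul, fderiv_apply_eq_sum_pd, Finset.sum_mul]
  exact Finset.sum_congr rfl fun B _ => Finset.sum_congr rfl fun A _ => by ring

/-- An identity between the components of an exterior derivative and of a wedge product holds on
all pairs of vectors. -/
theorem fderiv_coframeForm_sub_eq_wedge {m : ℕ} {Θ : (Fin m → ℝ) → Fin m → ℝ} {q : Fin m → ℝ}
    (hΘ : DifferentiableAt ℝ Θ q) {α β : Fin m → ℝ}
    (h : ∀ A B, pd A (fun q => Θ q B) q - pd B (fun q => Θ q A) q = α A * β B - α B * β A)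
    (a b : Fin m → ℝ) :
    fderiv ℝ (fun q => coframeForm (Θ q)) q a b - fderiv ℝ (fun q => coframeForm (Θ q)) q b a
      = coframeForm α a * coframeForm β b - coframeForm α b * coframeForm β a := by
  rw [fderiv_coframeForm_apply hΘ, fderiv_coframeForm_apply hΘ,
    Finset.sum_comm (f := fun A B => b A * a B * pd A (fun q => Θ q B) q)]
  simp only [coframeForm_apply]
  rw [mul_comm (∑ A, α A * b A), Finset.sum_mul_sum, Finset.sum_mul_sum,
    ← Finset.sum_sub_distrib, ← Finset.sum_sub_distrib]
  refine Finset.sum_congr rfl fun A _ => ?_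
  rw [← Finset.sum_sub_distrib, ← Finset.sum_sub_distrib]
  refine Finset.sum_congr rfl fun B _ => ?_
  linear_combination a A * b B * h A B

/-- The inverse function theorem on an open set: the local inverse is smooth on the whole image of
a neighbourhood. -/
theorem exists_smooth_local_inverse {E : Type*} [NormedAddCommGroup E] [NormedSpace ℝ E]
    [FiniteDimensional ℝ E] {f : E → E} {W : Set E} (hW : IsOpen W)
    (hf : ContDiffOn ℝ (⊤ : ℕ∞) f W)
    (hinj : ∀ q ∈ W, Function.Injective (fderiv ℝ f q)) {p : E} (hp : p ∈ W) :
    ∃ e : OpenPartialHomeomorph E E, p ∈ e.source ∧ e.source ⊆ W ∧ (e : E → E) = f ∧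
      ContDiffOn ℝ (⊤ : ℕ∞) e.symm e.target := by
  have : CompleteSpace E := FiniteDimensional.complete ℝ E
  have hcd : ∀ q ∈ W, ContDiffAt ℝ (⊤ : ℕ∞) f q := fun q hq => hf.contDiffAt (hW.mem_nhds hq)
  have hequiv : ∀ q ∈ W, ∃ f' : E ≃L[ℝ] E, HasFDerivAt f (f' : E →L[ℝ] E) q := by
    intro q hq
    refine ⟨(LinearEquiv.ofInjectiveEndo (fderiv ℝ f q : E →ₗ[ℝ] E)
      (hinj q hq)).toContinuousLinearEquiv, ?_⟩
    convert! ((hcd q hq).differentiableAt (by simp)).hasFDerivAt using 1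
  obtain ⟨f', hf'⟩ := hequiv p hp
  set e := ((hcd p hp).toOpenPartialHomeomorph f hf' (by simp)).restrOpen W hW with he
  have hef : (e : E → E) = f := rfl
  have hsub : e.source ⊆ W := fun q hq => hq.2
  refine ⟨e, ⟨(hcd p hp).mem_toOpenPartialHomeomorph_source hf' (by simp), hp⟩, hsub, hef, ?_⟩
  intro y hy
  obtain ⟨g', hg'⟩ := hequiv _ (hsub (e.map_target hy))
  exact (e.contDiffAt_symm hy hg' (hcd _ (hsub (e.map_target hy)))).contDiffWithinAt

/-- Local coordinates on `ℝ^m` whose components `i` and `j` are `u` and `v`. -/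
theorem exists_chart_extending {m : ℕ} {i j : Fin m} (hij : i ≠ j) {W : Set (Fin m → ℝ)}
    (hW : IsOpen W) {u v : (Fin m → ℝ) → ℝ} (hu : ContDiffOn ℝ (⊤ : ℕ∞) u W)
    (hv : ContDiffOn ℝ (⊤ : ℕ∞) v W)
    (hdet : ∀ q ∈ W, pd i u q * pd j v q - pd j u q * pd i v q ≠ 0)
    {p : Fin m → ℝ} (hp : p ∈ W) (hu₀ : u p = 0) (hv₀ : v p = 0) :
    ∃ e : OpenPartialHomeomorph (Fin m → ℝ) (Fin m → ℝ), p ∈ e.source ∧ e.source ⊆ W ∧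
      e p = 0 ∧ (∀ q, e q i = u q) ∧ (∀ q, e q j = v q) ∧
      ContDiffOn ℝ (⊤ : ℕ∞) e e.source ∧ ContDiffOn ℝ (⊤ : ℕ∞) e.symm e.target := by
  set f : (Fin m → ℝ) → Fin m → ℝ :=
    fun q A => if A = i then u q else if A = j then v q else q A - p A with hfdef
  have hfi : ∀ q, f q i = u q := fun q => by simp [hfdef]
  have hfj : ∀ q, f q j = v q := fun q => by simp [hfdef, hij.symm]
  have hfo : ∀ A, A ≠ i → A ≠ j → ∀ q, f q A = q A - p A :=
    fun A h1 h2 q => by simp [hfdef, h1, h2]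
  have hf : ContDiffOn ℝ (⊤ : ℕ∞) f W := by
    refine contDiffOn_pi.2 fun A => ?_
    by_cases h1 : A = i
    · subst h1; simpa only [hfi] using hu
    by_cases h2 : A = j
    · subst h2; simpa only [hfj] using hv
    simp only [hfo A h1 h2]
    fun_prop
  have hinj : ∀ q ∈ W, Function.Injective (fderiv ℝ f q) := by
    intro q hq
    rw [injective_iff_map_eq_zero]
    intro w hw
    have hfd : DifferentiableAt ℝ f q :=
      (hf.differentiableOn (by simp)).differentiableAt (hW.mem_nhds hq)
    have hcomp : ∀ A, fderiv ℝ (fun q => f q A) q w = 0 := by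
      intro A
      rw [fderiv_apply hfd, ContinuousLinearMap.comp_apply, hw, map_zero]
    have hwo : ∀ A, A ≠ i → A ≠ j → w A = 0 := by
      intro A h1 h2
      have h3 := hcomp A
      simp only [hfo A h1 h2] at h3
      have h4 : HasFDerivAt (fun q : Fin m → ℝ => q A - p A)
          (ContinuousLinearMap.proj (R := ℝ) (φ := fun _ : Fin m => ℝ) A) q :=
        (hasFDerivAt_apply A q).sub_const _
      rwa [h4.fderiv] at h3
    have hsum : ∀ g : (Fin m → ℝ) → ℝ, fderiv ℝ g q w = w i * pd i g q + w j * pd j g q := by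
      intro g
      rw [fderiv_apply_eq_sum_pd, ← Finset.sum_pair hij (f := fun A => w A * pd A g q)]
      refine (Finset.sum_subset (Finset.subset_univ _) fun A _ hA => ?_).symm
      simp only [Finset.mem_insert, Finset.mem_singleton, not_or] at hA
      rw [hwo A hA.1 hA.2, zero_mul]
    have hui := hcomp i
    have hvj := hcomp j
    simp only [hfi, hfj, hsum] at hui hvj
    have hwi : w i = 0 := (mul_eq_zero.1 (by linear_combination pd j v q * hui - pd j u q * hvj :
      w i * (pd i u q * pd j v q - pd j u q * pd i v q) = 0)).resolve_right (hdet q hq)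
    have hwj : w j = 0 := (mul_eq_zero.1 (by linear_combination pd i u q * hvj - pd i v q * hui :
      w j * (pd i u q * pd j v q - pd j u q * pd i v q) = 0)).resolve_right (hdet q hq)
    funext A
    by_cases h1 : A = i
    · rw [h1, hwi, Pi.zero_apply]
    by_cases h2 : A = j
    · rw [h2, hwj, Pi.zero_apply]
    exact hwo A h1 h2
  obtain ⟨e, hpe, hsub, hef, hsymm⟩ := exists_smooth_local_inverse hW hf hinj hp
  refine ⟨e, hpe, hsub, ?_, by rwa [hef], by rwa [hef], ?_, hsymm⟩
  · funext A
    rw [hef]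
    by_cases h1 : A = i
    · rw [h1, hfi, hu₀, Pi.zero_apply]
    by_cases h2 : A = j
    · rw [h2, hfj, hv₀, Pi.zero_apply]
    rw [hfo A h1 h2, sub_self, Pi.zero_apply]
  · rw [hef]; exact hf.mono hsub

/-- Around every point, a generic pseudo-spherical coframe has a chart in which its normal form
`(e⁻ᵛ du, dv, e⁻ᵛ du)` involves only the coordinates `u = z_i` and `v = z_j`. -/
theorem exists_chart_normal_form {m : ℕ} {i j : Fin m} (hij : i ≠ j) {V : Set (Fin m → ℝ)}
    (hV : IsOpen V) {Θ1 Θ2 Θ3 : (Fin m → ℝ) → Fin m → ℝ}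
    (hΘ1 : ContDiffOn ℝ (⊤ : ℕ∞) Θ1 V) (hΘ2 : ContDiffOn ℝ (⊤ : ℕ∞) Θ2 V)
    (hΘ3 : ContDiffOn ℝ (⊤ : ℕ∞) Θ3 V) (hstruct : StructEqM V Θ1 Θ2 Θ3)
    (hgen : ∀ p ∈ V, Θ1 p i * Θ2 p j - Θ1 p j * Θ2 p i ≠ 0) {p : Fin m → ℝ} (hp : p ∈ V) :
    ∃ (e : OpenPartialHomeomorph (Fin m → ℝ) (Fin m → ℝ)) (θ : (Fin m → ℝ) → ℝ),
      p ∈ e.source ∧ e.source ⊆ V ∧ e p = 0 ∧ ContDiffOn ℝ (⊤ : ℕ∞) e e.source ∧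
      ContDiffOn ℝ (⊤ : ℕ∞) e.symm e.target ∧ ContDiffOn ℝ (⊤ : ℕ∞) θ e.source ∧
      ∀ q ∈ e.source,
        HasFDerivAt θ (cos (θ q) • coframeForm (Θ1 q) + sin (θ q) • coframeForm (Θ2 q)
          - coframeForm (Θ3 q)) q ∧
        HasFDerivAt (fun z => e z j)
          (cos (θ q) • coframeForm (Θ2 q) - sin (θ q) • coframeForm (Θ1 q)) q ∧
        HasFDerivAt (fun z => e z i) (exp (e q j) •
          (cos (θ q) • coframeForm (Θ1 q) + sin (θ q) • coframeForm (Θ2 q))) q := by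
  have hd : ∀ {Θ : (Fin m → ℝ) → Fin m → ℝ}, ContDiffOn ℝ (⊤ : ℕ∞) Θ V → ∀ q ∈ V,
      DifferentiableAt ℝ Θ q := fun h q hq =>
    (h.differentiableOn (by simp)).differentiableAt (hV.mem_nhds hq)
  obtain ⟨r, hr, hrV, θ, u, v, hu0, hv0, hθ, hu, hv, hnf⟩ := exists_horocyclic_normal_form hV
    (contDiffOn_coframeForm hΘ1) (contDiffOn_coframeForm hΘ2) (contDiffOn_coframeForm hΘ3)
    (fun q hq => fderiv_coframeForm_sub_eq_wedge (hd hΘ1 q hq) fun A B => (hstruct q hq A B).1)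
    (fun q hq => fderiv_coframeForm_sub_eq_wedge (hd hΘ2 q hq) fun A B => (hstruct q hq A B).2.1)
    (fun q hq => fderiv_coframeForm_sub_eq_wedge (hd hΘ3 q hq) fun A B => (hstruct q hq A B).2.2)
    hp
  obtain ⟨e, hpe, hsub, he0, hei, hej, hes, hesymm⟩ := exists_chart_extending hij
    Metric.isOpen_ball hu hv
    (fun q hq => by
      obtain ⟨-, hv', hu'⟩ := hnf q hq
      simp only [pd, hv'.fderiv, hu'.fderiv, add_apply, sub_apply, smul_apply,
        coframeForm_single, smul_eq_mul]
      have h := mul_ne_zero (exp_ne_zero (v q)) (hgen q (hrV hq))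
      convert! h using 1
      linear_combination exp (v q) * (Θ1 q i * Θ2 q j - Θ1 q j * Θ2 q i)
        * sin_sq_add_cos_sq (θ q))
    (Metric.mem_ball_self hr) hu0 hv0
  refine ⟨e, θ, hpe, hsub.trans hrV, he0, hes, hesymm, hθ.mono hsub, fun q hq => ?_⟩
  simp only [hei, hej]
  exact hnf q (hsub hq)

/-- local correspondence between any two generic pseudo-spherical coframes in
`m` variables (Theorem 4 of the paper): there is a local diffeomorphism `Υ` and a gauge
function `μ` with `Υ*Θ̂¹ = Θ¹ cos μ + Θ² sin μ`, `Υ*Θ̂² = −Θ¹ sin μ + Θ² cos μ`,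
`Υ*Θ̂³ = Θ³ + dμ`. -/
theorem local_correspondence_of_hierarchies
    (m : ℕ) (hm : 2 ≤ m)
    (V Vh : Set (Fin m → ℝ)) (hV : IsOpen V) (hVh : IsOpen Vh)
    (Θ1 Θ2 Θ3 : (Fin m → ℝ) → Fin m → ℝ)
    (hΘ1 : ContDiffOn ℝ (⊤ : ℕ∞) Θ1 V) (hΘ2 : ContDiffOn ℝ (⊤ : ℕ∞) Θ2 V) (hΘ3 : ContDiffOn ℝ (⊤ : ℕ∞) Θ3 V)
    (Θh1 Θh2 Θh3 : (Fin m → ℝ) → Fin m → ℝ)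
    (hΘh1 : ContDiffOn ℝ (⊤ : ℕ∞) Θh1 Vh) (hΘh2 : ContDiffOn ℝ (⊤ : ℕ∞) Θh2 Vh)
    (hΘh3 : ContDiffOn ℝ (⊤ : ℕ∞) Θh3 Vh)
    (hstruct : StructEqM V Θ1 Θ2 Θ3) (hstructh : StructEqM Vh Θh1 Θh2 Θh3)
    (hgen : ∀ p ∈ V,
      Θ1 p ⟨0, by omega⟩ * Θ2 p ⟨1, by omega⟩
        - Θ1 p ⟨1, by omega⟩ * Θ2 p ⟨0, by omega⟩ ≠ 0)
    (hgenh : ∀ p ∈ Vh,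
      Θh1 p ⟨0, by omega⟩ * Θh2 p ⟨1, by omega⟩
        - Θh1 p ⟨1, by omega⟩ * Θh2 p ⟨0, by omega⟩ ≠ 0) :
    ∀ p ∈ V, ∀ ph ∈ Vh,
      ∃ (U Uh : Set (Fin m → ℝ)) (Υ Ξ : (Fin m → ℝ) → (Fin m → ℝ))
        (μ : (Fin m → ℝ) → ℝ),
        IsOpen U ∧ IsOpen Uh ∧ p ∈ U ∧ U ⊆ V ∧ ph ∈ Uh ∧ Uh ⊆ Vh ∧
        -- `Υ : U → Uh` is a diffeomorphism with smooth inverse `Ξ`: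
        ContDiffOn ℝ (⊤ : ℕ∞) Υ U ∧ ContDiffOn ℝ (⊤ : ℕ∞) Ξ Uh ∧
        Set.BijOn Υ U Uh ∧
        (∀ z ∈ U, Ξ (Υ z) = z) ∧ (∀ w ∈ Uh, Υ (Ξ w) = w) ∧
        Υ p = ph ∧
        ContDiffOn ℝ (⊤ : ℕ∞) μ U ∧
        ∀ q ∈ U, ∀ A : Fin m,
          (∑ B : Fin m, Θh1 (Υ q) B * pd A (fun z => Υ z B) q)
            = Θ1 q A * Real.cos (μ q) + Θ2 q A * Real.sin (μ q) ∧
          (∑ B : Fin m, Θh2 (Υ q) B * pd A (fun z => Υ z B) q)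
            = -Θ1 q A * Real.sin (μ q) + Θ2 q A * Real.cos (μ q) ∧
          (∑ B : Fin m, Θh3 (Υ q) B * pd A (fun z => Υ z B) q)
            = Θ3 q A + pd A μ q := by
  intro p hp ph hph
  have hij : (⟨0, by omega⟩ : Fin m) ≠ ⟨1, by omega⟩ := by simp
  obtain ⟨e, θ, hpe, heV, he0, hes, hesymm, hθ, hnf⟩ :=
    exists_chart_normal_form hij hV hΘ1 hΘ2 hΘ3 hstruct hgen hp
  obtain ⟨eh, θh, hphe, hehV, heh0, hehs, hehsymm, hθh, hnfh⟩ :=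
    exists_chart_normal_form hij hVh hΘh1 hΘh2 hΘh3 hstructh hgenh hph
  set Φ := e.trans eh.symm with hΦ
  have hsrc : Φ.source ⊆ e.source := fun q hq => hq.1
  have hmem : ∀ q ∈ Φ.source, e q ∈ eh.target := fun q hq => hq.2
  have htgt : Φ.target ⊆ eh.source := fun q hq => hq.1
  have hmemh : ∀ q ∈ Φ.target, eh q ∈ e.target := fun q hq => hq.2
  have hΦmem : ∀ q ∈ Φ.source, Φ q ∈ eh.source := fun q hq => htgt (Φ.map_source hq)
  have hehΦ : ∀ q ∈ Φ.source, eh (Φ q) = e q := fun q hq => eh.right_inv (hmem q hq)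
  have hΦp : Φ p = ph := by
    rw [hΦ, OpenPartialHomeomorph.trans_apply, he0, ← heh0, eh.left_inv hphe]
  have hpΦ : p ∈ Φ.source := ⟨hpe, by
    change e p ∈ eh.target
    rw [he0, ← heh0]
    exact eh.map_source hphe⟩
  have hΦs : ContDiffOn ℝ (⊤ : ℕ∞) Φ Φ.source := hehsymm.comp (hes.mono hsrc) hmem
  have hμ : ContDiffOn ℝ (⊤ : ℕ∞) (fun q => θ q - θh (Φ q)) Φ.source :=
    (hθ.mono hsrc).sub (hθh.comp hΦs hΦmem)
  refine ⟨Φ.source, Φ.target, Φ, Φ.symm, fun q => θ q - θh (Φ q), Φ.open_source, Φ.open_target,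
    hpΦ, hsrc.trans heV, hΦp ▸ Φ.map_source hpΦ, htgt.trans hehV, hΦs,
    hesymm.comp (hehs.mono htgt) hmemh, Φ.bijOn, fun z hz => Φ.left_inv hz,
    fun w hw => Φ.right_inv hw, hΦp, hμ, fun q hq A => ?_⟩
  have hΦd : HasFDerivAt Φ (fderiv ℝ Φ q) q :=
    ((hΦs.differentiableOn (by simp)).differentiableAt (Φ.open_source.mem_nhds hq)).hasFDerivAt
  set w := fderiv ℝ Φ q (Pi.single A 1) with hw
  have hpull : ∀ a : Fin m → ℝ, ∑ B, a B * pd A (fun z => Φ z B) q = coframeForm a w := by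
    intro a
    rw [coframeForm_apply]
    refine Finset.sum_congr rfl fun B _ => ?_
    rw [hw, pd, fderiv_apply hΦd.differentiableAt]
    rfl
  obtain ⟨hθ', hv', hu'⟩ := hnf q (hsrc hq)
  obtain ⟨hθh', hvh', huh'⟩ := hnfh (Φ q) (hΦmem q hq)
  have hcoord : ∀ B, (fun z => e z B) =ᶠ[nhds q] fun z => eh (Φ z) B := by
    intro B
    filter_upwards [Φ.open_source.mem_nhds hq] with z hz
    rw [hehΦ z hz]
  have hv := congrArg (fun L => L (Pi.single A 1))
    (hv'.unique ((hvh'.comp q hΦd).congr_of_eventuallyEq (hcoord _)))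
  have hu := congrArg (fun L => L (Pi.single A 1))
    (hu'.unique ((huh'.comp q hΦd).congr_of_eventuallyEq (hcoord _)))
  have hμ' : pd A (fun q => θ q - θh (Φ q)) q = _ :=
    congrArg (fun L => L (Pi.single A 1)) (hθ'.sub (hθh'.comp q hΦd)).fderiv
  rw [hehΦ q hq] at hu
  simp only [ContinuousLinearMap.comp_apply, add_apply, sub_apply, smul_apply,
    coframeForm_single, smul_eq_mul, ← hw] at hv hu hμ'
  replace hu := mul_left_cancel₀ (exp_ne_zero _) hu
  simp only [hpull, hμ', cos_sub, sin_sub]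
  have hcs := sin_sq_add_cos_sq (θh (Φ q))
  refine ⟨?_, ?_, ?_⟩
  · linear_combination (-coframeForm (Θh1 (Φ q)) w) * hcs - cos (θh (Φ q)) * hu
      + sin (θh (Φ q)) * hv
  · linear_combination (-coframeForm (Θh2 (Φ q)) w) * hcs - sin (θh (Φ q)) * hu
      - cos (θh (Φ q)) * hv
  · linear_combination -hu
end

section
/- Let V, V̂ ⊆ ℝ² be open sets with coordinates (x,t) and (x̂,t̂). Let f_{αβ} : V → ℝ and f̂_{αβ} : V̂ → ℝ (α = 1,2,3; β = 1,2) be smooth functions, each collection satisfying the structure equations of a pseudo-spherical surface, and suppose f₂₁f₃₂ − f₂₂f₃₁ ≠ 0 everywhere on V and f̂₂₁f̂₃₂ − f̂₂₂f̂₃₁ ≠ 0 everywhere on V̂. Then for every p ∈ V and p̂ ∈ V̂ there exist open neighborhoods U ⊆ V of p and Û ⊆ V̂ of p̂, a diffeomorphism Ψ = (γ,δ) : U → Û with Ψ(p) = p̂, and a smooth function ν : U → ℝ, such that on U: (f̂₁₁∘Ψ)·∂ₓγ + (f̂₁₂∘Ψ)·∂ₓδ = f₁₁ + ∂ₓν and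 (f̂₁₁∘Ψ)·∂ₜγ + (f̂₁₂∘Ψ)·∂ₜδ = f₁₂ + ∂ₜν; (f̂₂₁∘Ψ)·∂ₓγ + (f̂₂₂∘Ψ)·∂ₓδ = f₂₁ cosh ν + f₃₁ sinh ν and (f̂₂₁∘Ψ)·∂ₜγ + (f̂₂₂∘Ψ)·∂ₜδ = f₂₂ cosh ν + f₃₂ sinh ν; (f̂₃₁∘Ψ)·∂ₓγ + (f̂₃₂∘Ψ)·∂ₓδ = f₂₁ sinh ν + f₃₁ cosh ν and (f̂₃₁∘Ψ)·∂ₜγ + (f̂₃₂∘Ψ)·∂ₜδ = f₂₂ sinh ν + f₃₂ cosh ν (i.e., Ψ*ω̂¹ = ω¹ + dν, Ψ*ω̂² = ω² cosh ν + ω³ sinh ν, Ψ*ω̂³ = ω² sinh ν + ω³ cosh ν). -/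
open Real

open Set Metric Filter in
/-- The **Picard-Lindelöf theorem**, recording that the solution stays in the ball on which the
vector field is controlled. -/
theorem IsPicardLindelof.exists_eq_forall_mem_Icc_mem_closedBall
    {E : Type*} [NormedAddCommGroup E] [NormedSpace ℝ E] [CompleteSpace E]
    {f : ℝ → E → E} {tmin tmax : ℝ} {t₀ : Icc tmin tmax} {x₀ x : E} {a r L K : NNReal}
    (hf : IsPicardLindelof f t₀ x₀ a r L K) (hx : x ∈ closedBall x₀ r) :
    ∃ α : ℝ → E, α t₀ = x ∧ ∀ t ∈ Icc tmin tmax,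
      α t ∈ closedBall x₀ a ∧ HasDerivWithinAt α (f t (α t)) (Icc tmin tmax) t := by
  obtain ⟨α, hα⟩ := ODE.FunSpace.exists_isFixedPt_next hf hx
  refine ⟨α.compProj, by rw [ODE.FunSpace.compProj_val, ← hα, ODE.FunSpace.next_apply₀],
    fun t ht ↦ ⟨α.compProj_mem_closedBall hf.mul_max_le, ?_⟩⟩
  apply ODE.hasDerivWithinAt_picard_Icc t₀.2 hf.continuousOn_uncurry
    α.continuous_compProj.continuousOn (fun _ ht' ↦ α.compProj_mem_closedBall hf.mul_max_le)
    x ht |>.congr_of_mem _ ht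
  intro t' ht'
  nth_rw 1 [← hα]
  rw [ODE.FunSpace.compProj_of_mem ht', ODE.FunSpace.next_apply]

theorem gronwallBound_zero_eq_mul (K ε x : ℝ) :
    gronwallBound 0 K ε x = ε * gronwallBound 0 K 1 x := by
  unfold gronwallBound
  split_ifs <;> ring

section Frobenius

open Set Metric Filter Topology

variable {E F : Type*} [NormedAddCommGroup E] [NormedSpace ℝ E]
  [NormedAddCommGroup F] [NormedSpace ℝ F]

/-- Two solutions of the radial equations attached to `Φ`, in the directions `q` and `q + h`,
differ at time `1` by `Φ h` up to a quadratic error. -/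
theorem norm_radial_sub_sub_le {Φ : E × F → E →L[ℝ] F} {x₀ : E} {y₀ : F} {r : ℝ} {M K L : NNReal}
    (hdiff : ∀ z ∈ closedBall (x₀, y₀) (2 * r), DifferentiableAt ℝ Φ z)
    (hM : ∀ z ∈ closedBall (x₀, y₀) (2 * r), ‖Φ z‖ ≤ M)
    (hK : ∀ z ∈ closedBall (x₀, y₀) (2 * r), ‖fderiv ℝ Φ z‖ ≤ K)
    (hL : LipschitzOnWith L (fderiv ℝ Φ) (closedBall (x₀, y₀) (2 * r)))
    (hint : ∀ z ∈ closedBall (x₀, y₀) (2 * r), ∀ h k : E,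
      fderiv ℝ Φ z (h, Φ z h) k = fderiv ℝ Φ z (k, Φ z k) h)
    {q h : E} (hq : ‖q‖ ≤ r) (hqh : ‖q + h‖ ≤ r) (hq1 : ‖q + h‖ ≤ 1) (hh : M * ‖h‖ ≤ r)
    {y w : ℝ → F} (hy0 : y 0 = y₀) (hw0 : w 0 = y₀)
    (hy : ∀ s ∈ Icc (0 : ℝ) 1, y s ∈ closedBall y₀ r ∧
      HasDerivWithinAt y (Φ (x₀ + s • q, y s) q) (Icc 0 1) s)
    (hw : ∀ s ∈ Icc (0 : ℝ) 1, w s ∈ closedBall y₀ r ∧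
      HasDerivWithinAt w (Φ (x₀ + s • (q + h), w s) (q + h)) (Icc 0 1) s) :
    ‖w 1 - y 1 - Φ (x₀ + q, y 1) h‖ ≤
      ((L * (1 + M) ^ 2 + K * (1 + M)) * gronwallBound 0 K 1 1) * ‖h‖ ^ 2 := by
  have hr : 0 ≤ r := (norm_nonneg q).trans hq
  have key : ∀ s ∈ Icc (0 : ℝ) 1, ∀ p : E, ‖p‖ ≤ r → ∀ b ∈ closedBall y₀ (2 * r),
      (x₀ + s • p, b) ∈ closedBall (x₀, y₀) (2 * r) := by
    intro s hs p hp b hb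
    rw [← closedBall_prod_same]
    refine ⟨?_, hb⟩
    rw [mem_closedBall, dist_self_add_left, norm_smul, Real.norm_of_nonneg hs.1]
    nlinarith [hs.2, norm_nonneg p]
  have hyB : ∀ s ∈ Icc (0 : ℝ) 1, (x₀ + s • q, y s) ∈ closedBall (x₀, y₀) (2 * r) := fun s hs =>
    key s hs q hq _ (closedBall_subset_closedBall (by linarith) (hy s hs).1)
  set v : ℝ → F := fun s => y s + s • Φ (x₀ + s • q, y s) h with hv
  have hvmem : ∀ s ∈ Icc (0 : ℝ) 1, v s ∈ closedBall y₀ (2 * r) := by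
    intro s hs
    have h1 : ‖s • Φ (x₀ + s • q, y s) h‖ ≤ r := by
      rw [norm_smul, Real.norm_of_nonneg hs.1]
      have := (Φ (x₀ + s • q, y s)).le_of_opNorm_le (hM _ (hyB s hs)) h
      nlinarith [hs.1, hs.2, norm_nonneg (Φ (x₀ + s • q, y s) h)]
    have h2 := (hy s hs).1
    rw [mem_closedBall, dist_eq_norm] at h2 ⊢
    calc ‖v s - y₀‖ = ‖(y s - y₀) + s • Φ (x₀ + s • q, y s) h‖ := by
          rw [hv, ← add_sub_right_comm]
      _ ≤ 2 * r := by linarith [norm_add_le (y s - y₀) (s • Φ (x₀ + s • q, y s) h)]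
  have hvd : ∀ s ∈ Icc (0 : ℝ) 1, HasDerivWithinAt v (Φ (x₀ + s • q, y s) (q + h) +
      fderiv ℝ Φ (x₀ + s • q, y s) (s • h, s • Φ (x₀ + s • q, y s) h) q) (Icc 0 1) s := by
    intro s hs
    have hz : HasDerivWithinAt (fun s : ℝ => (x₀ + s • q, y s)) (q, Φ (x₀ + s • q, y s) q)
        (Icc 0 1) s := by
      refine HasDerivWithinAt.prodMk ?_ (hy s hs).2
      simpa using (((hasDerivAt_id s).smul_const q).const_add x₀).hasDerivWithinAt
    have hΦ := (hdiff _ (hyB s hs)).hasFDerivAt.comp_hasDerivWithinAt s hz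
    have := (hy s hs).2.add ((hasDerivWithinAt_id s (Icc 0 1)).smul
      (hΦ.clm_apply (hasDerivWithinAt_const s (Icc 0 1) h)))
    refine this.congr_deriv ?_
    have e : ((s • h, s • Φ (x₀ + s • q, y s) h) : E × F) = s • (h, Φ (x₀ + s • q, y s) h) := rfl
    rw [e, map_smul]
    simp [hint _ (hyB s hs) h q]
    abel
  have hlip : ∀ s ∈ Ico (0 : ℝ) 1, LipschitzOnWith K
      (fun b => Φ (x₀ + s • (q + h), b) (q + h)) (closedBall y₀ (2 * r)) := by
    intro s hs
    refine LipschitzOnWith.of_dist_le_mul fun b hb c hc => ?_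
    have h1 := (convex_closedBall (x₀, y₀) (2 * r)).norm_image_sub_le_of_norm_fderiv_le hdiff hK
      (key s ⟨hs.1, hs.2.le⟩ _ hqh c hc) (key s ⟨hs.1, hs.2.le⟩ _ hqh b hb)
    have h2 : ‖((x₀ + s • (q + h), b) : E × F) - (x₀ + s • (q + h), c)‖ = ‖b - c‖ := by
      simp [Prod.norm_def]
    rw [h2] at h1
    rw [dist_eq_norm, dist_eq_norm, ← sub_apply]
    refine (ContinuousLinearMap.le_of_opNorm_le _ h1 _).trans ?_
    exact mul_le_of_le_one_right (by positivity) hq1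
  have herr : ∀ s ∈ Ico (0 : ℝ) 1, dist (Φ (x₀ + s • q, y s) (q + h) +
      fderiv ℝ Φ (x₀ + s • q, y s) (s • h, s • Φ (x₀ + s • q, y s) h) q)
      (Φ (x₀ + s • (q + h), v s) (q + h)) ≤ (L * (1 + M) ^ 2 + K * (1 + M)) * ‖h‖ ^ 2 := by
    intro s hs
    have hs' : s ∈ Icc (0 : ℝ) 1 := ⟨hs.1, hs.2.le⟩
    set z : E × F := (x₀ + s • q, y s) with hz
    set k : E × F := (s • h, s • Φ z h) with hk
    have hzk : ((x₀ + s • (q + h), v s) : E × F) = z + k := by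
      simp [hz, hk, hv, add_assoc]
    have hkn : ‖k‖ ≤ (1 + M) * ‖h‖ := by
      have hΦh := (Φ z).le_of_opNorm_le (hM _ (hyB s hs')) h
      have hn := norm_nonneg h
      have hm : (0 : ℝ) ≤ M * ‖h‖ := by positivity
      rw [hk, Prod.norm_def]
      refine max_le ?_ ?_ <;> simp only [norm_smul, Real.norm_of_nonneg hs.1]
      · nlinarith [hs.1, hs.2]
      · nlinarith [hs.1, hs.2, norm_nonneg (Φ z h)]
    have hzB := hyB s hs'
    have hzkB : z + k ∈ closedBall (x₀, y₀) (2 * r) := hzk ▸ key s hs' _ hqh _ (hvmem s hs')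
    have htaylor : ‖Φ (z + k) - Φ z - fderiv ℝ Φ z k‖ ≤ L * ‖k‖ * ‖k‖ := by
      have hseg : segment ℝ z (z + k) ⊆ closedBall (x₀, y₀) (2 * r) :=
        (convex_closedBall _ _).segment_subset hzB hzkB
      have := (convex_segment z (z + k)).norm_image_sub_le_of_norm_fderiv_le' (C := L * ‖k‖)
        (φ := fderiv ℝ Φ z) (fun x hx => hdiff x (hseg hx)) (fun x hx => ?_)
        (left_mem_segment ℝ _ _) (right_mem_segment ℝ _ _)
      · simpa using this
      · refine (hL.norm_sub_le (hseg hx) hzB).trans ?_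
        gcongr
        have := norm_sub_le_of_mem_segment hx
        simpa using this
    rw [hzk, dist_comm, dist_eq_norm]
    have e : Φ (z + k) (q + h) - (Φ z (q + h) + fderiv ℝ Φ z k q) =
        (Φ (z + k) - Φ z - fderiv ℝ Φ z k) (q + h) + fderiv ℝ Φ z k h := by
      simp; abel
    rw [e]
    have h1 := ContinuousLinearMap.le_of_opNorm_le _ htaylor (q + h)
    have h2 := ContinuousLinearMap.le_of_opNorm_le _
      (ContinuousLinearMap.le_of_opNorm_le _ (hK z hzB) k) h
    calc _ ≤ L * ‖k‖ * ‖k‖ * ‖q + h‖ + K * ‖k‖ * ‖h‖ := (norm_add_le _ _).trans (add_le_add h1 h2)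
      _ ≤ L * ((1 + M) * ‖h‖) * ((1 + M) * ‖h‖) * 1 + K * ((1 + M) * ‖h‖) * ‖h‖ := by gcongr
      _ = _ := by ring
  have hIci : ∀ s ∈ Ico (0 : ℝ) 1, Icc (0 : ℝ) 1 ∈ 𝓝[≥] s := fun s hs => Icc_mem_nhdsGE_of_mem hs
  have := dist_le_of_approx_trajectories_ODE_of_mem (f := w) (g := v) (εf := 0) (δ := 0) hlip
    (fun s hs => (hw s hs).2.continuousWithinAt)
    (fun s hs => (hw s (Ico_subset_Icc_self hs)).2.mono_of_mem_nhdsWithin (hIci s hs))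
    (fun s hs => (dist_self _).le)
    (fun s hs => closedBall_subset_closedBall (by linarith) (hw s (Ico_subset_Icc_self hs)).1)
    (fun s hs => (hvd s hs).continuousWithinAt)
    (fun s hs => (hvd s (Ico_subset_Icc_self hs)).mono_of_mem_nhdsWithin (hIci s hs))
    herr (fun s hs => hvmem s (Ico_subset_Icc_self hs)) (by simp [hv, hy0, hw0])
    1 (right_mem_Icc.2 zero_le_one)
  rw [gronwallBound_zero_eq_mul, dist_eq_norm] at this
  calc _ = ‖w 1 - v 1‖ := by simp [hv, sub_sub]
    _ ≤ _ := this
    _ = _ := by simp; ring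

/-- **Frobenius theorem** for total differential equations `du = Φ (x, u)`: a smooth right-hand
side satisfying the integrability condition admits a local smooth solution with prescribed value
at a point. -/
theorem exists_contDiffOn_hasFDerivAt_of_integrable [CompleteSpace F]
    {W : Set (E × F)} (hW : IsOpen W)
    {Φ : E × F → E →L[ℝ] F} (hΦ : ContDiffOn ℝ (⊤ : ℕ∞) Φ W)
    (hint : ∀ z ∈ W, ∀ h k : E, fderiv ℝ Φ z (h, Φ z h) k = fderiv ℝ Φ z (k, Φ z k) h)
    {x₀ : E} {y₀ : F} (h₀ : (x₀, y₀) ∈ W) :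
    ∃ (U : Set E) (u : E → F), IsOpen U ∧ x₀ ∈ U ∧ u x₀ = y₀ ∧ ContDiffOn ℝ (⊤ : ℕ∞) u U ∧
      ∀ x ∈ U, (x, u x) ∈ W ∧ HasFDerivAt u (Φ (x, u x)) x := by
  have hΦ₀ : ContDiffAt ℝ (⊤ : ℕ∞) Φ (x₀, y₀) := hΦ.contDiffAt (hW.mem_nhds h₀)
  have hΦ₁ : ContDiffAt ℝ 1 (fderiv ℝ Φ) (x₀, y₀) := hΦ₀.fderiv_right (by norm_cast)
  obtain ⟨L, t, ht, hL⟩ := hΦ₁.exists_lipschitzOnWith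
  have hMev : ∀ᶠ z in 𝓝 (x₀, y₀), ‖Φ z‖ ≤ (‖Φ (x₀, y₀)‖₊ + 1 : NNReal) :=
    (hΦ₀.continuousAt.norm.eventually_lt_const (lt_add_one _)).mono fun z hz => hz.le
  have hKev : ∀ᶠ z in 𝓝 (x₀, y₀), ‖fderiv ℝ Φ z‖ ≤ (‖fderiv ℝ Φ (x₀, y₀)‖₊ + 1 : NNReal) :=
    (((continuous_norm (E := E × F →L[ℝ] E →L[ℝ] F)).continuousAt.comp
      hΦ₁.continuousAt).eventually_lt_const (lt_add_one _)).mono fun z hz => hz.le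
  set M : NNReal := ‖Φ (x₀, y₀)‖₊ + 1
  set K : NNReal := ‖fderiv ℝ Φ (x₀, y₀)‖₊ + 1
  have hWev : ∀ᶠ z in 𝓝 (x₀, y₀), z ∈ W := hW.mem_nhds h₀
  have htev : ∀ᶠ z in 𝓝 (x₀, y₀), z ∈ t := ht
  obtain ⟨ε, hε, hball⟩ := nhds_basis_closedBall.eventually_iff.1
    ((hMev.and hKev).and (hWev.and htev))
  obtain ⟨r, hr, rfl⟩ : ∃ r : NNReal, 0 < r ∧ ε = 2 * r :=
    ⟨(ε / 2).toNNReal, by simpa using hε, by rw [Real.coe_toNNReal _ (by positivity)]; ring⟩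
  have hdiff : ∀ z ∈ closedBall (x₀, y₀) (2 * r), DifferentiableAt ℝ Φ z := fun z hz =>
    (hΦ.contDiffAt (hW.mem_nhds (hball hz).2.1)).differentiableAt (by simp)
  have hLB : LipschitzOnWith L (fderiv ℝ Φ) (closedBall (x₀, y₀) (2 * r)) :=
    hL.mono fun z hz => (hball hz).2.2
  have hM1 : (0 : ℝ) < M + 1 := by positivity
  obtain ⟨ρ, hρ, hρr, hρ1, hρM⟩ : ∃ ρ : ℝ, 0 < ρ ∧ ρ ≤ r ∧ ρ ≤ 1 ∧ M * ρ ≤ r := by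
    refine ⟨min (r : ℝ) 1 / (M + 1), by positivity, ?_, ?_, ?_⟩
    · exact (div_le_self (by positivity) (by simp)).trans (min_le_left _ _)
    · exact (div_le_self (by positivity) (by simp)).trans (min_le_right _ _)
    · rw [mul_div_assoc', div_le_iff₀ hM1]
      nlinarith [min_le_left (r : ℝ) 1, M.coe_nonneg, r.coe_nonneg]
  have hsol : ∀ x ∈ ball x₀ ρ, ∃ y : ℝ → F, y 0 = y₀ ∧ ∀ s ∈ Icc (0 : ℝ) 1,
      y s ∈ closedBall y₀ r ∧
        HasDerivWithinAt y (Φ (x₀ + s • (x - x₀), y s) (x - x₀)) (Icc 0 1) s := by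
    intro x hx
    have hxn : ‖x - x₀‖ < ρ := by rwa [mem_ball, dist_eq_norm] at hx
    have hmem : ∀ s ∈ Icc (0 : ℝ) 1, ∀ b ∈ closedBall y₀ r,
        (x₀ + s • (x - x₀), b) ∈ closedBall (x₀, y₀) (2 * r) := by
      intro s hs b hb
      rw [← closedBall_prod_same]
      refine ⟨?_, closedBall_subset_closedBall (by linarith [r.coe_nonneg]) hb⟩
      rw [mem_closedBall, dist_self_add_left, norm_smul, Real.norm_of_nonneg hs.1]
      nlinarith [hs.2, norm_nonneg (x - x₀), r.coe_nonneg]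
    have hPL : IsPicardLindelof (fun s b => Φ (x₀ + s • (x - x₀), b) (x - x₀))
        (⟨0, left_mem_Icc.2 zero_le_one⟩ : Icc (0 : ℝ) 1) y₀ r 0 r K := by
      refine ⟨fun s hs => LipschitzOnWith.of_dist_le_mul fun b hb c hc => ?_, fun b hb s hs => ?_,
        fun s hs b hb => ?_, by simp⟩
      · have h1 := (convex_closedBall (x₀, y₀) (2 * r)).norm_image_sub_le_of_norm_fderiv_le hdiff
          (fun z hz => (hball hz).1.2) (hmem s hs c hc) (hmem s hs b hb)
        have h2 : ‖((x₀ + s • (x - x₀), b) : E × F) - (x₀ + s • (x - x₀), c)‖ = ‖b - c‖ := by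
          simp [Prod.norm_def]
        rw [h2] at h1
        rw [dist_eq_norm, dist_eq_norm, ← sub_apply]
        refine (ContinuousLinearMap.le_of_opNorm_le _ h1 _).trans ?_
        exact mul_le_of_le_one_right (by positivity) (by linarith)
      · have h1 : ContinuousAt (fun s : ℝ => (x₀ + s • (x - x₀), b)) s := by fun_prop
        exact ((ContinuousAt.comp (f := fun s : ℝ => (x₀ + s • (x - x₀), b))
          (hdiff _ (hmem s hs b hb)).continuousAt h1).clm_apply
            continuousAt_const).continuousWithinAt
      · refine (ContinuousLinearMap.le_of_opNorm_le _ (hball (hmem s hs b hb)).1.1 _).trans ?_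
        nlinarith [M.coe_nonneg]
    obtain ⟨y, h1, h2⟩ := hPL.exists_eq_forall_mem_Icc_mem_closedBall
      (mem_closedBall_self (by simp))
    exact ⟨y, h1, h2⟩
  choose! Y hY0 hY using hsol
  set u : E → F := fun x => Y x 1 with hu
  have huW : ∀ x ∈ ball x₀ ρ, (x, u x) ∈ closedBall (x₀, y₀) (2 * r) := by
    intro x hx
    rw [← closedBall_prod_same]
    refine ⟨closedBall_subset_closedBall (by linarith [r.coe_nonneg]) (ball_subset_closedBall hx),
      closedBall_subset_closedBall (by linarith [r.coe_nonneg]) (hY x hx 1 (by simp)).1⟩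
  have hder : ∀ x ∈ ball x₀ ρ, HasFDerivAt u (Φ (x, u x)) x := by
    intro x hx
    set C : ℝ := (L * (1 + M) ^ 2 + K * (1 + M)) * gronwallBound 0 K 1 1
    have hle : ∀ᶠ x' in 𝓝 x, ‖u x' - u x - Φ (x, u x) (x' - x)‖ ≤ C * ‖‖x' - x‖ ^ 2‖ := by
      filter_upwards [isOpen_ball.mem_nhds hx, ball_mem_nhds x hρ] with x' hx' hxx'
      have e : x - x₀ + (x' - x) = x' - x₀ := by abel
      have e' : x₀ + (x - x₀) = x := by abel
      have hxn : ‖x - x₀‖ < ρ := by rwa [mem_ball, dist_eq_norm] at hx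
      have hxn' : ‖x' - x₀‖ < ρ := by rwa [mem_ball, dist_eq_norm] at hx'
      have hd : ‖x' - x‖ < ρ := by rwa [mem_ball, dist_eq_norm] at hxx'
      have := norm_radial_sub_sub_le (q := x - x₀) (h := x' - x) hdiff
        (fun z hz => (hball hz).1.1) (fun z hz => (hball hz).1.2) hLB
        (fun z hz => hint z (hball hz).2.1) (by linarith) (by rw [e]; linarith)
        (by rw [e]; linarith) (by nlinarith [M.coe_nonneg]) (hY0 x hx) (hY0 x' hx')
        (hY x hx) (by rw [e]; exact hY x' hx')
      rw [e'] at this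
      simpa using this
    rw [hasFDerivAt_iff_isLittleO]
    refine (Asymptotics.IsBigO.of_bound C hle).trans_isLittleO ?_
    have hn : Tendsto (fun x' => x' - x) (𝓝 x) (𝓝 0) := by
      simpa using (tendsto_id (x := 𝓝 x)).sub_const x
    exact (Asymptotics.isLittleO_norm_pow_id one_lt_two).comp_tendsto hn
  refine ⟨ball x₀ ρ, u, isOpen_ball, mem_ball_self hρ, ?_, ?_,
    fun x hx => ⟨(hball (huW x hx)).2.1, hder x hx⟩⟩
  · have hx := mem_ball_self (x := x₀) hρ
    have h1 := constant_of_has_deriv_right_zero (f := Y x₀) (a := 0) (b := 1)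
      (fun s hs => (hY x₀ hx s hs).2.continuousWithinAt)
      (fun s hs => by
        simpa using (hY x₀ hx s (Ico_subset_Icc_self hs)).2.mono_of_mem_nhdsWithin
          (Icc_mem_nhdsGE_of_mem hs))
    rw [hu]
    exact (h1 1 (by simp)).trans (hY0 x₀ hx)
  · rw [contDiffOn_infty]
    intro n
    induction n with
    | zero => exact contDiffOn_zero.2 fun x hx => (hder x hx).continuousAt.continuousWithinAt
    | succ n ih =>
      push_cast
      rw [contDiffOn_succ_iff_hasFDerivWithinAt_of_uniqueDiffOn isOpen_ball.uniqueDiffOn]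
      refine ⟨by simp, fun x => Φ (x, u x), ?_, fun x hx => (hder x hx).hasFDerivWithinAt⟩
      exact (hΦ.of_le (by exact_mod_cast le_top)).comp (contDiffOn_id.prodMk ih)
        fun x hx => (hball (huW x hx)).2.1

end Frobenius

/-- **Frobenius theorem** for a pair of equations `∂ₓ u = A (q, u)`, `∂ₜ u = B (q, u)` in the
plane. -/
theorem exists_contDiffOn_hasFDerivAt_of_mixed_eq
    {F : Type*} [NormedAddCommGroup F] [NormedSpace ℝ F] [CompleteSpace F]
    {W : Set ((ℝ × ℝ) × F)} (hW : IsOpen W) {A B : (ℝ × ℝ) × F → F}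
    (hA : ContDiffOn ℝ (⊤ : ℕ∞) A W) (hB : ContDiffOn ℝ (⊤ : ℕ∞) B W)
    (hmixed : ∀ z ∈ W, fderiv ℝ A z ((0, 1), B z) = fderiv ℝ B z ((1, 0), A z))
    {p : ℝ × ℝ} {y : F} (hp : (p, y) ∈ W) :
    ∃ (U : Set (ℝ × ℝ)) (u : ℝ × ℝ → F), IsOpen U ∧ p ∈ U ∧ u p = y ∧
      ContDiffOn ℝ (⊤ : ℕ∞) u U ∧ ∀ q ∈ U, (q, u q) ∈ W ∧
        HasFDerivAt u ((ContinuousLinearMap.fst ℝ ℝ ℝ).smulRight (A (q, u q)) +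
          (ContinuousLinearMap.snd ℝ ℝ ℝ).smulRight (B (q, u q))) q := by
  set Φ : (ℝ × ℝ) × F → (ℝ × ℝ) →L[ℝ] F := fun z =>
    (ContinuousLinearMap.fst ℝ ℝ ℝ).smulRight (A z) +
      (ContinuousLinearMap.snd ℝ ℝ ℝ).smulRight (B z) with hΦ
  refine exists_contDiffOn_hasFDerivAt_of_integrable (Φ := Φ) hW
    ((contDiffOn_const.smulRight hA).add (contDiffOn_const.smulRight hB)) (fun z hz h k => ?_) hp
  have hAd := (hA.contDiffAt (hW.mem_nhds hz)).differentiableAt (by simp)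
  have hBd := (hB.contDiffAt (hW.mem_nhds hz)).differentiableAt (by simp)
  have happ : ∀ v k, fderiv ℝ Φ z v k = k.1 • fderiv ℝ A z v + k.2 • fderiv ℝ B z v := by
    intro v k
    have hΦd : DifferentiableAt ℝ Φ z :=
      (((ContinuousLinearMap.smulRightL ℝ (ℝ × ℝ) F
          (ContinuousLinearMap.fst ℝ ℝ ℝ)).differentiableAt).comp z hAd).add
        (((ContinuousLinearMap.smulRightL ℝ (ℝ × ℝ) F
          (ContinuousLinearMap.snd ℝ ℝ ℝ)).differentiableAt).comp z hBd)
    have h1 := hΦd.hasFDerivAt.clm_apply (hasFDerivAt_const k z)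
    have h2 := (hAd.hasFDerivAt.const_smul k.1).add (hBd.hasFDerivAt.const_smul k.2)
    simpa using DFunLike.congr_fun (h1.unique h2) v
  have hdir : ∀ h : ℝ × ℝ, ((h, Φ z h) : (ℝ × ℝ) × F) =
      h.1 • ((1, 0), A z) + h.2 • ((0, 1), B z) := by
    intro h
    ext <;> simp [hΦ]
  rw [happ, happ, hdir, hdir]
  simp only [map_add, map_smul, hmixed z hz, smul_add, smul_smul]
  rw [mul_comm k.1 h.1, mul_comm k.2 h.1, mul_comm k.1 h.2, mul_comm k.2 h.2]
  abel

/-- A smooth map with injective derivatives between open subsets of a finite-dimensional space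
restricts to a diffeomorphism near each point. -/
theorem exists_openPartialHomeomorph_of_injective_fderiv
    {E : Type*} [NormedAddCommGroup E] [NormedSpace ℝ E] [FiniteDimensional ℝ E]
    {U V : Set E} (hU : IsOpen U) (hV : IsOpen V) {Ψ : E → E} {Ψ' : E → E →L[ℝ] E}
    (hΨ : ContDiffOn ℝ (⊤ : ℕ∞) Ψ U) (hΨ' : ∀ x ∈ U, HasFDerivAt Ψ (Ψ' x) x)
    (hinj : ∀ x ∈ U, Function.Injective (Ψ' x)) {p : E} (hp : p ∈ U) (hpV : Ψ p ∈ V) :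
    ∃ e : OpenPartialHomeomorph E E, ⇑e = Ψ ∧ p ∈ e.source ∧ e.source ⊆ U ∧ e.target ⊆ V ∧
      ContDiffOn ℝ (⊤ : ℕ∞) e.symm e.target := by
  have : CompleteSpace E := FiniteDimensional.complete ℝ E
  have hequiv : ∀ x ∈ U, ∃ L : E ≃L[ℝ] E, (L : E →L[ℝ] E) = Ψ' x := fun x hx =>
    ⟨(LinearEquiv.ofInjectiveEndo (Ψ' x : E →ₗ[ℝ] E) (hinj x hx)).toContinuousLinearEquiv, by
      ext; rfl⟩
  have hat : ∀ x ∈ U, ContDiffAt ℝ (⊤ : ℕ∞) Ψ x := fun x hx => hΨ.contDiffAt (hU.mem_nhds hx)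
  obtain ⟨L, hL⟩ := hequiv p hp
  set e₀ := (hat p hp).toOpenPartialHomeomorph Ψ (f' := L) (hL ▸ hΨ' p hp) (by simp)
  have hS : IsOpen (U ∩ Ψ ⁻¹' V) := hΨ.continuousOn.isOpen_inter_preimage hU hV
  set e := e₀.restrOpen _ hS
  have hsource : e.source ⊆ U ∩ Ψ ⁻¹' V := fun x hx => hx.2
  refine ⟨e, rfl, ⟨ContDiffAt.mem_toOpenPartialHomeomorph_source _ _ _, hp, hpV⟩,
    fun x hx => (hsource hx).1, fun y hy => ?_, fun y hy => ?_⟩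
  · have h1 : Ψ (e.symm y) ∈ V := (hsource (e.map_target hy)).2
    have h2 : Ψ (e.symm y) = y := e.right_inv hy
    rwa [h2] at h1
  · have hx := (hsource (e.map_target hy)).1
    obtain ⟨L', hL'⟩ := hequiv _ hx
    exact (e.contDiffAt_symm hy (f₀' := L') (hL' ▸ hΨ' _ hx) (hat _ hx)).contDiffWithinAt

theorem exists_contDiffOn_cramer {G : Type*} [NormedAddCommGroup G] [NormedSpace ℝ G]
    {W : Set G} {n : WithTop ℕ∞} {a b c d X Y : G → ℝ}
    (ha : ContDiffOn ℝ n a W) (hb : ContDiffOn ℝ n b W) (hc : ContDiffOn ℝ n c W)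
    (hd : ContDiffOn ℝ n d W) (hX : ContDiffOn ℝ n X W) (hY : ContDiffOn ℝ n Y W)
    (hdet : ∀ z ∈ W, a z * d z - b z * c z ≠ 0) :
    ∃ u v : G → ℝ, ContDiffOn ℝ n u W ∧ ContDiffOn ℝ n v W ∧
      ∀ z ∈ W, a z * u z + b z * v z = X z ∧ c z * u z + d z * v z = Y z := by
  refine ⟨fun z => (d z * X z - b z * Y z) / (a z * d z - b z * c z),
    fun z => (a z * Y z - c z * X z) / (a z * d z - b z * c z),
    ((hd.mul hX).sub (hb.mul hY)).div ((ha.mul hd).sub (hb.mul hc)) hdet,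
    ((ha.mul hY).sub (hc.mul hX)).div ((ha.mul hd).sub (hb.mul hc)) hdet, fun z hz => ?_⟩
  have := hdet z hz
  constructor <;>
  · rw [mul_div_assoc', mul_div_assoc', ← add_div, div_eq_iff this]
    ring

theorem fderiv_apply_eq_pdx_add_pdt (f : ℝ × ℝ → ℝ) (p v : ℝ × ℝ) :
    fderiv ℝ f p v = v.1 * pdx f p + v.2 * pdt f p := by
  have : v = v.1 • ((1 : ℝ), (0 : ℝ)) + v.2 • ((0 : ℝ), (1 : ℝ)) := by ext <;> simp
  conv_lhs => rw [this, map_add, map_smul, map_smul]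
  rfl

/-- Pulling back the coframe `g` in one coordinate direction: the components of `A` are the
derivatives of `(γ, δ)` and `ν` in that direction, expressed at the point `(q, (γ, δ), ν)`, and
`f₁, f₂, f₃` are the corresponding coefficients of the coframe `f`. -/
def IsPullbackColumn (W : Set ((ℝ × ℝ) × (ℝ × ℝ) × ℝ)) (f₁ f₂ f₃ : ℝ × ℝ → ℝ)
    (g11 g12 g21 g22 g31 g32 : ℝ × ℝ → ℝ)
    (A : (ℝ × ℝ) × (ℝ × ℝ) × ℝ → (ℝ × ℝ) × ℝ) : Prop :=
  ∀ z ∈ W,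
    g11 z.2.1 * (A z).1.1 + g12 z.2.1 * (A z).1.2 = f₁ z.1 + (A z).2 ∧
    g21 z.2.1 * (A z).1.1 + g22 z.2.1 * (A z).1.2 =
      f₂ z.1 * cosh z.2.2 + f₃ z.1 * sinh z.2.2 ∧
    g31 z.2.1 * (A z).1.1 + g32 z.2.1 * (A z).1.2 =
      f₂ z.1 * sinh z.2.2 + f₃ z.1 * cosh z.2.2

section Pullback

variable {V Vh : Set (ℝ × ℝ)} {g11 g12 g21 g22 g31 g32 : ℝ × ℝ → ℝ}

theorem exists_isPullbackColumn {f₁ f₂ f₃ : ℝ × ℝ → ℝ}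
    (hf₁ : ContDiffOn ℝ (⊤ : ℕ∞) f₁ V) (hf₂ : ContDiffOn ℝ (⊤ : ℕ∞) f₂ V)
    (hf₃ : ContDiffOn ℝ (⊤ : ℕ∞) f₃ V)
    (hg11 : ContDiffOn ℝ (⊤ : ℕ∞) g11 Vh) (hg12 : ContDiffOn ℝ (⊤ : ℕ∞) g12 Vh)
    (hg21 : ContDiffOn ℝ (⊤ : ℕ∞) g21 Vh) (hg22 : ContDiffOn ℝ (⊤ : ℕ∞) g22 Vh)
    (hg31 : ContDiffOn ℝ (⊤ : ℕ∞) g31 Vh) (hg32 : ContDiffOn ℝ (⊤ : ℕ∞) g32 Vh)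
    (hgen : ∀ w ∈ Vh, g21 w * g32 w - g22 w * g31 w ≠ 0) :
    ∃ A, ContDiffOn ℝ (⊤ : ℕ∞) A (V ×ˢ Vh ×ˢ Set.univ) ∧
      IsPullbackColumn (V ×ˢ Vh ×ˢ Set.univ) f₁ f₂ f₃ g11 g12 g21 g22 g31 g32 A := by
  have hf : ∀ {f : ℝ × ℝ → ℝ}, ContDiffOn ℝ (⊤ : ℕ∞) f V → ContDiffOn ℝ (⊤ : ℕ∞)
      (fun z : (ℝ × ℝ) × (ℝ × ℝ) × ℝ => f z.1) (V ×ˢ Vh ×ˢ Set.univ) := fun h =>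
    h.comp contDiff_fst.contDiffOn fun z hz => hz.1
  have hg : ∀ {g : ℝ × ℝ → ℝ}, ContDiffOn ℝ (⊤ : ℕ∞) g Vh → ContDiffOn ℝ (⊤ : ℕ∞)
      (fun z : (ℝ × ℝ) × (ℝ × ℝ) × ℝ => g z.2.1) (V ×ˢ Vh ×ˢ Set.univ) := fun h =>
    h.comp contDiff_snd.fst.contDiffOn fun z hz => hz.2.1
  have hc : ContDiffOn ℝ (⊤ : ℕ∞) (fun z : (ℝ × ℝ) × (ℝ × ℝ) × ℝ => cosh z.2.2)
      (V ×ˢ Vh ×ˢ Set.univ) := contDiff_snd.snd.cosh.contDiffOn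
  have hs : ContDiffOn ℝ (⊤ : ℕ∞) (fun z : (ℝ × ℝ) × (ℝ × ℝ) × ℝ => sinh z.2.2)
      (V ×ˢ Vh ×ˢ Set.univ) := contDiff_snd.snd.sinh.contDiffOn
  obtain ⟨a, b, ha, hb, hab⟩ := exists_contDiffOn_cramer (hg hg21) (hg hg22) (hg hg31) (hg hg32)
    (((hf hf₂).mul hc).add ((hf hf₃).mul hs)) (((hf hf₂).mul hs).add ((hf hf₃).mul hc))
    fun z hz => hgen _ hz.2.1
  exact ⟨fun z => ((a z, b z), g11 z.2.1 * a z + g12 z.2.1 * b z - f₁ z.1),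
    (ha.prodMk hb).prodMk ((((hg hg11).mul ha).add ((hg hg12).mul hb)).sub (hf hf₁)),
    fun z hz => ⟨by ring, hab z hz⟩⟩

/-- The derivative of the relations in `IsPullbackColumn` in a direction `v`. -/
theorem IsPullbackColumn.fderiv_apply {W : Set ((ℝ × ℝ) × (ℝ × ℝ) × ℝ)} {f₁ f₂ f₃ : ℝ × ℝ → ℝ}
    {A : (ℝ × ℝ) × (ℝ × ℝ) × ℝ → (ℝ × ℝ) × ℝ}
    (hA : IsPullbackColumn W f₁ f₂ f₃ g11 g12 g21 g22 g31 g32 A) {z : (ℝ × ℝ) × (ℝ × ℝ) × ℝ}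
    (hW : W ∈ nhds z) (hAd : DifferentiableAt ℝ A z)
    (hf₁ : DifferentiableAt ℝ f₁ z.1) (hf₂ : DifferentiableAt ℝ f₂ z.1)
    (hf₃ : DifferentiableAt ℝ f₃ z.1)
    (hg11 : DifferentiableAt ℝ g11 z.2.1) (hg12 : DifferentiableAt ℝ g12 z.2.1)
    (hg21 : DifferentiableAt ℝ g21 z.2.1) (hg22 : DifferentiableAt ℝ g22 z.2.1)
    (hg31 : DifferentiableAt ℝ g31 z.2.1) (hg32 : DifferentiableAt ℝ g32 z.2.1)
    (v : (ℝ × ℝ) × (ℝ × ℝ) × ℝ) :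
    fderiv ℝ g11 z.2.1 v.2.1 * (A z).1.1 + g11 z.2.1 * (fderiv ℝ A z v).1.1 +
      (fderiv ℝ g12 z.2.1 v.2.1 * (A z).1.2 + g12 z.2.1 * (fderiv ℝ A z v).1.2) =
        fderiv ℝ f₁ z.1 v.1 + (fderiv ℝ A z v).2 ∧
    fderiv ℝ g21 z.2.1 v.2.1 * (A z).1.1 + g21 z.2.1 * (fderiv ℝ A z v).1.1 +
      (fderiv ℝ g22 z.2.1 v.2.1 * (A z).1.2 + g22 z.2.1 * (fderiv ℝ A z v).1.2) =
        fderiv ℝ f₂ z.1 v.1 * cosh z.2.2 + f₂ z.1 * (sinh z.2.2 * v.2.2) +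
          (fderiv ℝ f₃ z.1 v.1 * sinh z.2.2 + f₃ z.1 * (cosh z.2.2 * v.2.2)) ∧
    fderiv ℝ g31 z.2.1 v.2.1 * (A z).1.1 + g31 z.2.1 * (fderiv ℝ A z v).1.1 +
      (fderiv ℝ g32 z.2.1 v.2.1 * (A z).1.2 + g32 z.2.1 * (fderiv ℝ A z v).1.2) =
        fderiv ℝ f₂ z.1 v.1 * sinh z.2.2 + f₂ z.1 * (cosh z.2.2 * v.2.2) +
          (fderiv ℝ f₃ z.1 v.1 * cosh z.2.2 + f₃ z.1 * (sinh z.2.2 * v.2.2)) := by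
  set c : ℝ → (ℝ × ℝ) × (ℝ × ℝ) × ℝ := fun s => z + s • v with hc
  have hc0 : c 0 = z := by simp [hc]
  have hcd : HasDerivAt c v 0 :=
    (((hasDerivAt_id (0 : ℝ)).smul_const v).const_add z).congr_deriv (one_smul _ _)
  have hcW : ∀ᶠ s in nhds (0 : ℝ), c s ∈ W :=
    hcd.continuousAt.eventually (by rw [hc0]; exact hW)
  have h21 : HasDerivAt (fun s => (c s).2.1) v.2.1 0 := hcd.snd.fst
  have hn : HasDerivAt (fun s => (c s).2.2) v.2.2 0 := hcd.snd.snd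
  have hf : ∀ {f : ℝ × ℝ → ℝ}, DifferentiableAt ℝ f z.1 →
      HasDerivAt (fun s => f (c s).1) (fderiv ℝ f z.1 v.1) 0 := fun {f} h => by
    have hd : HasFDerivAt f (fderiv ℝ f z.1) (c 0).1 := by rw [hc0]; exact h.hasFDerivAt
    exact hd.comp_hasDerivAt (0 : ℝ) hcd.fst
  have hg : ∀ {g : ℝ × ℝ → ℝ}, DifferentiableAt ℝ g z.2.1 →
      HasDerivAt (fun s => g (c s).2.1) (fderiv ℝ g z.2.1 v.2.1) 0 := fun {g} h => by
    have hd : HasFDerivAt g (fderiv ℝ g z.2.1) (c 0).2.1 := by rw [hc0]; exact h.hasFDerivAt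
    exact hd.comp_hasDerivAt (0 : ℝ) h21
  have hAc : HasDerivAt (fun s => A (c s)) (fderiv ℝ A z v) 0 := by
    have hd : HasFDerivAt A (fderiv ℝ A z) (c 0) := by rw [hc0]; exact hAd.hasFDerivAt
    exact hd.comp_hasDerivAt (0 : ℝ) hcd
  have ha : HasDerivAt (fun s => (A (c s)).1.1) (fderiv ℝ A z v).1.1 0 := hAc.fst.fst
  have hb : HasDerivAt (fun s => (A (c s)).1.2) (fderiv ℝ A z v).1.2 0 := hAc.fst.snd
  refine ⟨?_, ?_, ?_⟩
  · have := (((hg hg11).mul ha).add ((hg hg12).mul hb)).unique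
      (((hf hf₁).add hAc.snd).congr_of_eventuallyEq (hcW.mono fun s hs => (hA _ hs).1))
    simpa only [hc0] using this
  · have := (((hg hg21).mul ha).add ((hg hg22).mul hb)).unique
      ((((hf hf₂).mul hn.cosh).add ((hf hf₃).mul hn.sinh)).congr_of_eventuallyEq
        (hcW.mono fun s hs => (hA _ hs).2.1))
    simpa only [hc0] using this
  · have := (((hg hg31).mul ha).add ((hg hg32).mul hb)).unique
      ((((hf hf₂).mul hn.sinh).add ((hf hf₃).mul hn.cosh)).congr_of_eventuallyEq
        (hcW.mono fun s hs => (hA _ hs).2.2))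
    simpa only [hc0] using this

/-- The structure equations of both coframes make the system for `((γ, δ), ν)` integrable. -/
theorem IsPullbackColumn.mixed_eq {W : Set ((ℝ × ℝ) × (ℝ × ℝ) × ℝ)} (hW : IsOpen W)
    {f11 f12 f21 f22 f31 f32 : ℝ × ℝ → ℝ} {A B : (ℝ × ℝ) × (ℝ × ℝ) × ℝ → (ℝ × ℝ) × ℝ}
    (hA : IsPullbackColumn W f11 f21 f31 g11 g12 g21 g22 g31 g32 A)
    (hB : IsPullbackColumn W f12 f22 f32 g11 g12 g21 g22 g31 g32 B)
    {z : (ℝ × ℝ) × (ℝ × ℝ) × ℝ} (hz : z ∈ W) (hzV : z.1 ∈ V) (hzVh : z.2.1 ∈ Vh)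
    (hAd : DifferentiableAt ℝ A z) (hBd : DifferentiableAt ℝ B z)
    (hf11 : DifferentiableAt ℝ f11 z.1) (hf12 : DifferentiableAt ℝ f12 z.1)
    (hf21 : DifferentiableAt ℝ f21 z.1) (hf22 : DifferentiableAt ℝ f22 z.1)
    (hf31 : DifferentiableAt ℝ f31 z.1) (hf32 : DifferentiableAt ℝ f32 z.1)
    (hg11 : DifferentiableAt ℝ g11 z.2.1) (hg12 : DifferentiableAt ℝ g12 z.2.1)
    (hg21 : DifferentiableAt ℝ g21 z.2.1) (hg22 : DifferentiableAt ℝ g22 z.2.1)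
    (hg31 : DifferentiableAt ℝ g31 z.2.1) (hg32 : DifferentiableAt ℝ g32 z.2.1)
    (hstruct : StructEq V f11 f12 f21 f22 f31 f32)
    (hstructh : StructEq Vh g11 g12 g21 g22 g31 g32)
    (hgen : g21 z.2.1 * g32 z.2.1 - g22 z.2.1 * g31 z.2.1 ≠ 0) :
    fderiv ℝ A z ((0, 1), B z) = fderiv ℝ B z ((1, 0), A z) := by
  have hWz := hW.mem_nhds hz
  obtain ⟨A1, A2, A3⟩ := hA z hz
  obtain ⟨B1, B2, B3⟩ := hB z hz
  obtain ⟨S1, S2, S3⟩ := hstruct z.1 hzV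
  obtain ⟨T1, T2, T3⟩ := hstructh z.2.1 hzVh
  obtain ⟨DA1, DA2, DA3⟩ := hA.fderiv_apply hWz hAd hf11 hf21 hf31 hg11 hg12 hg21 hg22 hg31 hg32
    ((0, 1), B z)
  obtain ⟨DB1, DB2, DB3⟩ := hB.fderiv_apply hWz hBd hf12 hf22 hf32 hg11 hg12 hg21 hg22 hg31 hg32
    ((1, 0), A z)
  simp only [fderiv_apply_eq_pdx_add_pdt, zero_mul, zero_add, one_mul, add_zero]
    at DA1 DA2 DA3 DB1 DB2 DB3
  set w := z.2.1
  set n := z.2.2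
  set dA := fderiv ℝ A z ((0, 1), B z)
  set dB := fderiv ℝ B z ((1, 0), A z)
  have hX : g21 w * (dA.1.1 - dB.1.1) + g22 w * (dA.1.2 - dB.1.2) = 0 := by
    linear_combination DA2 - DB2
      - ((B z).1.1 * (A z).1.2 - (A z).1.1 * (B z).1.2) * T2 - cosh n * S2 - sinh n * S3
      + (f22 z.1 * sinh n + f32 z.1 * cosh n) * A1 - (f21 z.1 * sinh n + f31 z.1 * cosh n) * B1
      + (g11 w * (A z).1.1 + g12 w * (A z).1.2) * B3 - (g11 w * (B z).1.1 + g12 w * (B z).1.2) * A3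
  have hY : g31 w * (dA.1.1 - dB.1.1) + g32 w * (dA.1.2 - dB.1.2) = 0 := by
    linear_combination DA3 - DB3
      - ((B z).1.1 * (A z).1.2 - (A z).1.1 * (B z).1.2) * T3 - sinh n * S2 - cosh n * S3
      + (f22 z.1 * cosh n + f32 z.1 * sinh n) * A1 - (f21 z.1 * cosh n + f31 z.1 * sinh n) * B1
      + (g11 w * (A z).1.1 + g12 w * (A z).1.2) * B2 - (g11 w * (B z).1.1 + g12 w * (B z).1.2) * A2
  have ha : dA.1.1 = dB.1.1 := by
    refine sub_eq_zero.1 ((mul_eq_zero.1 ?_).resolve_left hgen)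
    linear_combination g32 w * hX - g22 w * hY
  have hb : dA.1.2 = dB.1.2 := by
    refine sub_eq_zero.1 ((mul_eq_zero.1 ?_).resolve_left hgen)
    linear_combination g21 w * hY - g31 w * hX
  have hn : dA.2 = dB.2 := by
    rw [ha, hb] at DA1
    linear_combination DB1 - DA1
      + ((B z).1.1 * (A z).1.2 - (A z).1.1 * (B z).1.2) * T1 + S1
      + (f21 z.1 * f32 z.1 - f31 z.1 * f22 z.1) * cosh_sq n
      + (g31 w * (B z).1.1 + g32 w * (B z).1.2) * A2
      + (f21 z.1 * cosh n + f31 z.1 * sinh n) * B3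
      - (g31 w * (A z).1.1 + g32 w * (A z).1.2) * B2
      - (f22 z.1 * cosh n + f32 z.1 * sinh n) * A3
  exact Prod.ext (Prod.ext ha hb) hn

end Pullback

/-- local correspondence between `I`-generic pseudo-spherical coframes
(Theorem 3 of the paper): there is a local diffeomorphism `Ψ = (γ, δ)` and a function `ν`
with `Ψ*ω̂¹ = ω¹ + dν`, `Ψ*ω̂² = ω² cosh ν + ω³ sinh ν`, `Ψ*ω̂³ = ω² sinh ν + ω³ cosh ν`. -/
theorem local_correspondence_I_generic
    (V Vh : Set (ℝ × ℝ)) (hV : IsOpen V) (hVh : IsOpen Vh)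
    (f11 f12 f21 f22 f31 f32 : ℝ × ℝ → ℝ)
    (hf11 : ContDiffOn ℝ (⊤ : ℕ∞) f11 V) (hf12 : ContDiffOn ℝ (⊤ : ℕ∞) f12 V)
    (hf21 : ContDiffOn ℝ (⊤ : ℕ∞) f21 V) (hf22 : ContDiffOn ℝ (⊤ : ℕ∞) f22 V)
    (hf31 : ContDiffOn ℝ (⊤ : ℕ∞) f31 V) (hf32 : ContDiffOn ℝ (⊤ : ℕ∞) f32 V)
    (g11 g12 g21 g22 g31 g32 : ℝ × ℝ → ℝ)
    (hg11 : ContDiffOn ℝ (⊤ : ℕ∞) g11 Vh) (hg12 : ContDiffOn ℝ (⊤ : ℕ∞) g12 Vh)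
    (hg21 : ContDiffOn ℝ (⊤ : ℕ∞) g21 Vh) (hg22 : ContDiffOn ℝ (⊤ : ℕ∞) g22 Vh)
    (hg31 : ContDiffOn ℝ (⊤ : ℕ∞) g31 Vh) (hg32 : ContDiffOn ℝ (⊤ : ℕ∞) g32 Vh)
    (hstruct : StructEq V f11 f12 f21 f22 f31 f32)
    (hstructh : StructEq Vh g11 g12 g21 g22 g31 g32)
    (hgen : ∀ p ∈ V, f21 p * f32 p - f22 p * f31 p ≠ 0)
    (hgenh : ∀ p ∈ Vh, g21 p * g32 p - g22 p * g31 p ≠ 0) :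
    ∀ p ∈ V, ∀ ph ∈ Vh,
      ∃ (U Uh : Set (ℝ × ℝ)) (γ δ : ℝ × ℝ → ℝ) (Ξ : ℝ × ℝ → ℝ × ℝ) (ν : ℝ × ℝ → ℝ),
        IsOpen U ∧ IsOpen Uh ∧ p ∈ U ∧ U ⊆ V ∧ ph ∈ Uh ∧ Uh ⊆ Vh ∧
        -- `Ψ = (γ, δ) : U → Uh` is a diffeomorphism with smooth inverse `Ξ`:
        ContDiffOn ℝ (⊤ : ℕ∞) γ U ∧ ContDiffOn ℝ (⊤ : ℕ∞) δ U ∧ ContDiffOn ℝ (⊤ : ℕ∞) Ξ Uh ∧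
        Set.BijOn (fun q => (γ q, δ q)) U Uh ∧
        (∀ z ∈ U, Ξ (γ z, δ z) = z) ∧ (∀ w ∈ Uh, (γ (Ξ w), δ (Ξ w)) = w) ∧
        (γ p, δ p) = ph ∧
        ContDiffOn ℝ (⊤ : ℕ∞) ν U ∧
        (∀ q ∈ U,
          g11 (γ q, δ q) * pdx γ q + g12 (γ q, δ q) * pdx δ q = f11 q + pdx ν q ∧
          g11 (γ q, δ q) * pdt γ q + g12 (γ q, δ q) * pdt δ q = f12 q + pdt ν q ∧
          g21 (γ q, δ q) * pdx γ q + g22 (γ q, δ q) * pdx δ q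
            = f21 q * Real.cosh (ν q) + f31 q * Real.sinh (ν q) ∧
          g21 (γ q, δ q) * pdt γ q + g22 (γ q, δ q) * pdt δ q
            = f22 q * Real.cosh (ν q) + f32 q * Real.sinh (ν q) ∧
          g31 (γ q, δ q) * pdx γ q + g32 (γ q, δ q) * pdx δ q
            = f21 q * Real.sinh (ν q) + f31 q * Real.cosh (ν q) ∧
          g31 (γ q, δ q) * pdt γ q + g32 (γ q, δ q) * pdt δ q
            = f22 q * Real.sinh (ν q) + f32 q * Real.cosh (ν q)) := by
  intro p hp ph hph
  set W : Set ((ℝ × ℝ) × (ℝ × ℝ) × ℝ) := V ×ˢ Vh ×ˢ Set.univ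
  have hW : IsOpen W := hV.prod (hVh.prod isOpen_univ)
  obtain ⟨A, hAs, hA⟩ :=
    exists_isPullbackColumn hf11 hf21 hf31 hg11 hg12 hg21 hg22 hg31 hg32 hgenh
  obtain ⟨B, hBs, hB⟩ :=
    exists_isPullbackColumn hf12 hf22 hf32 hg11 hg12 hg21 hg22 hg31 hg32 hgenh
  have hdiff : ∀ {G H : Type} [NormedAddCommGroup G] [NormedSpace ℝ G] [NormedAddCommGroup H]
      [NormedSpace ℝ H] {S : Set G} {f : G → H} {z : G}, IsOpen S → ContDiffOn ℝ (⊤ : ℕ∞) f S →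
      z ∈ S → DifferentiableAt ℝ f z := fun hS hf hz =>
    (hf.contDiffAt (hS.mem_nhds hz)).differentiableAt (by simp)
  obtain ⟨U₀, u, hU₀, hpU₀, hup, hus, hu⟩ := exists_contDiffOn_hasFDerivAt_of_mixed_eq hW hAs hBs
    (fun z hz => hA.mixed_eq hW hB hz hz.1 hz.2.1 (hdiff hW hAs hz) (hdiff hW hBs hz)
      (hdiff hV hf11 hz.1) (hdiff hV hf12 hz.1) (hdiff hV hf21 hz.1) (hdiff hV hf22 hz.1)
      (hdiff hV hf31 hz.1) (hdiff hV hf32 hz.1) (hdiff hVh hg11 hz.2.1) (hdiff hVh hg12 hz.2.1)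
      (hdiff hVh hg21 hz.2.1) (hdiff hVh hg22 hz.2.1) (hdiff hVh hg31 hz.2.1)
      (hdiff hVh hg32 hz.2.1) hstruct hstructh (hgenh _ hz.2.1))
    (p := p) (y := (ph, 0)) ⟨hp, hph, Set.mem_univ _⟩
  have hinj : ∀ q ∈ U₀, Function.Injective ((ContinuousLinearMap.fst ℝ (ℝ × ℝ) ℝ).comp
      ((ContinuousLinearMap.fst ℝ ℝ ℝ).smulRight (A (q, u q)) +
        (ContinuousLinearMap.snd ℝ ℝ ℝ).smulRight (B (q, u q)))) := by
    intro q hq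
    have hqW := (hu q hq).1
    obtain ⟨-, A2, A3⟩ := hA _ hqW
    obtain ⟨-, B2, B3⟩ := hB _ hqW
    have hdet : (A (q, u q)).1.1 * (B (q, u q)).1.2 - (A (q, u q)).1.2 * (B (q, u q)).1.1 ≠ 0 := by
      intro h0
      refine hgen q hqW.1 ?_
      simp only at A2 A3 B2 B3
      linear_combination (g21 (u q).1 * g32 (u q).1 - g22 (u q).1 * g31 (u q).1) * h0
        - (f21 q * f32 q - f22 q * f31 q) * cosh_sq (u q).2
        - (g31 (u q).1 * (B (q, u q)).1.1 + g32 (u q).1 * (B (q, u q)).1.2) * A2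
        - (f21 q * cosh (u q).2 + f31 q * sinh (u q).2) * B3
        + (g31 (u q).1 * (A (q, u q)).1.1 + g32 (u q).1 * (A (q, u q)).1.2) * B2
        + (f22 q * cosh (u q).2 + f32 q * sinh (u q).2) * A3
    rw [injective_iff_map_eq_zero]
    rintro ⟨h, k⟩ hhk
    obtain ⟨e₁, e₂⟩ : h * (A (q, u q)).1.1 + k * (B (q, u q)).1.1 = 0 ∧
        h * (A (q, u q)).1.2 + k * (B (q, u q)).1.2 = 0 := by
      simpa [Prod.ext_iff] using hhk
    refine Prod.ext ((mul_eq_zero.1 ?_).resolve_left hdet) ((mul_eq_zero.1 ?_).resolve_left hdet)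
    · linear_combination (B (q, u q)).1.2 * e₁ - (B (q, u q)).1.1 * e₂
    · linear_combination (A (q, u q)).1.1 * e₂ - (A (q, u q)).1.2 * e₁
  obtain ⟨e, he, hpe, heU, heV, hes⟩ := exists_openPartialHomeomorph_of_injective_fderiv hU₀ hVh
    (Ψ := fun q => (u q).1) hus.fst
    (fun q hq => (ContinuousLinearMap.fst ℝ (ℝ × ℝ) ℝ).hasFDerivAt.comp q (hu q hq).2)
    hinj hpU₀ (by simpa [hup] using hph)
  have hpe' : e p = ph := by rw [he]; simp [hup]
  have hue : ∀ q, (u q).1 = e q := fun q => by rw [he]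
  refine ⟨e.source, e.target, fun q => (u q).1.1, fun q => (u q).1.2, e.symm, fun q => (u q).2,
    e.open_source, e.open_target, hpe, fun q hq => (hu q (heU hq)).1.1, hpe' ▸ e.map_source hpe,
    heV, (hus.fst.fst).mono heU, (hus.fst.snd).mono heU, hes, ?_, ?_, ?_, ?_, hus.snd.mono heU, ?_⟩
  · simpa only [Prod.mk.eta, hue] using e.bijOn
  · intro z hz
    simpa only [Prod.mk.eta, hue] using e.left_inv hz
  · intro w hw
    simpa only [Prod.mk.eta, hue] using e.right_inv hw
  · rw [Prod.mk.eta, hue, hpe']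
  · intro q hq
    obtain ⟨hqW, hd⟩ := hu q (heU hq)
    have hγ := hd.fst.fst.fderiv
    have hδ := hd.fst.snd.fderiv
    have hν := hd.snd.fderiv
    obtain ⟨A1, A2, A3⟩ := hA _ hqW
    obtain ⟨B1, B2, B3⟩ := hB _ hqW
    simp only [pdx, pdt, hγ, hδ, hν]
    simpa using ⟨A1, B1, A2, B2, A3, B3⟩
end
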